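/- arXiv:2502.05956 — 13 statements merged into one kernel-verified Lean document; each statement's English description precedes it below -/
import Mathlib

section
/- Let R be a commutative ring, A a nonunital commutative R-algebra, hA : DividedPowers I_A a divided power structure on the augmentation ideal I_A of Unitization R A, Ω = KaehlerDifferential R (Unitization R A) with universal derivation D, and let φ be a DP-module family on Ω satisfying D (hA.dpow n a) = φ n (D a) + ∑_{i=1}^{n-1} (hA.dpow i a) • φ (n-i) (D a) for all a ∈ I_A, n ≥ 1. Then for every (Unitization R A)-module M equipped with a DP-module family ψ and every R-derivation d : Unitization R A → M satisfying d (hA.dpow n a) = ψ n (d a) + ∑_{i=1}^{n-1} (hA.dpow i a) • ψ (n-i) (d a) for all a ∈ I_A, n ≥ 1, there exists a unique (Unitization R A)-linear map f : Ω → M such that f (D s) = d s for all s ∈ Unitization R A and f (φ n ω) = ψ n (f ω) for all ω ∈ Ω and n ≥ 1. -/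
/-- A divided power module family on an `S`-module `M`: a family of additive maps
`phi n : M →+ M` (`n ≥ 1`) with `phi 1 = id`, `phi n (s • x) = s ^ n • phi n x`,
`((m+n).choose m) • phi (m+n) x = 0` and
`phi m (phi n x) = (Nat.uniformBell m n) • phi (m*n) x`. -/
structure DPModuleFamily (S : Type*) [CommRing S] (M : Type*) [AddCommGroup M]
    [Module S M] where
  phi : ℕ → M →+ M
  phi_one : phi 1 = AddMonoidHom.id M
  phi_smul : ∀ n : ℕ, 1 ≤ n → ∀ (s : S) (x : M), phi n (s • x) = s ^ n • phi n x
  choose_smul_phi : ∀ m n : ℕ, 1 ≤ m → 1 ≤ n → ∀ x : M,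
    ((m + n).choose m) • phi (m + n) x = 0
  phi_comp : ∀ m n : ℕ, 1 ≤ m → 1 ≤ n → ∀ x : M,
    phi m (phi n x) = (Nat.uniformBell m n) • phi (m * n) x

/-- universal property of the divided power Kähler differentials. -/
theorem kaehler_dp_universal_property (R : Type*) [CommRing R]
    (A : Type*) [NonUnitalCommRing A] [Module R A]
    [IsScalarTower R A A] [SMulCommClass R A A]
    (hA : DividedPowers (RingHom.ker (Unitization.fstHom R A)))
    (φ : DPModuleFamily (Unitization R A) (KaehlerDifferential R (Unitization R A)))
    (hφ : ∀ a ∈ RingHom.ker (Unitization.fstHom R A), ∀ n : ℕ, 1 ≤ n →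
      KaehlerDifferential.D R (Unitization R A) (hA.dpow n a) =
        φ.phi n (KaehlerDifferential.D R (Unitization R A) a) +
          ∑ i ∈ Finset.Ico 1 n,
            hA.dpow i a • φ.phi (n - i) (KaehlerDifferential.D R (Unitization R A) a)) :
    ∀ (M : Type*) [AddCommGroup M] [Module R M] [Module (Unitization R A) M]
      [IsScalarTower R (Unitization R A) M]
      (ψ : DPModuleFamily (Unitization R A) M)
      (d : Derivation R (Unitization R A) M),
      (∀ a ∈ RingHom.ker (Unitization.fstHom R A), ∀ n : ℕ, 1 ≤ n →
        d (hA.dpow n a) = ψ.phi n (d a) +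
          ∑ i ∈ Finset.Ico 1 n, hA.dpow i a • ψ.phi (n - i) (d a)) →
      ∃! f : KaehlerDifferential R (Unitization R A) →ₗ[Unitization R A] M,
        (∀ s : Unitization R A, f (KaehlerDifferential.D R (Unitization R A) s) = d s) ∧
        (∀ (ω : KaehlerDifferential R (Unitization R A)) (n : ℕ), 1 ≤ n →
          f (φ.phi n ω) = ψ.phi n (f ω)) := by
  intro M _ _ _ _ ψ d hd
  have hD (a : Unitization R A) (ha : a ∈ RingHom.ker (Unitization.fstHom R A)) (n : ℕ)
      (hn : 1 ≤ n) :
      d.liftKaehlerDifferential (φ.phi n (KaehlerDifferential.D R (Unitization R A) a)) =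
        ψ.phi n (d a) := by
    induction n using Nat.strong_induction_on with
    | _ n ih =>
      have key := congrArg d.liftKaehlerDifferential (hφ a ha n hn)
      rw [Derivation.liftKaehlerDifferential_comp_D, hd a ha n hn, map_add, map_sum] at key
      have hsum : ∑ i ∈ Finset.Ico 1 n, d.liftKaehlerDifferential
            (hA.dpow i a • φ.phi (n - i) (KaehlerDifferential.D R (Unitization R A) a)) =
          ∑ i ∈ Finset.Ico 1 n, hA.dpow i a • ψ.phi (n - i) (d a) := by
        refine Finset.sum_congr rfl fun i hi => ?_
        rw [Finset.mem_Ico] at hi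
        rw [map_smul, ih (n - i) (by omega) (by omega)]
      rw [hsum] at key
      exact (add_right_cancel key).symm
  refine ⟨d.liftKaehlerDifferential, ⟨d.liftKaehlerDifferential_comp_D, fun ω n hn => ?_⟩,
    fun g hg => Derivation.liftKaehlerDifferential_unique _ _ ?_⟩
  · have hω : ω ∈ Submodule.span (Unitization R A)
        (Set.range (KaehlerDifferential.D R (Unitization R A))) := by
      rw [KaehlerDifferential.span_range_derivation]
      trivial
    induction hω using Submodule.span_induction with
    | mem x hx =>
      obtain ⟨s, rfl⟩ := hx
      have hs : KaehlerDifferential.D R (Unitization R A) s =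
          KaehlerDifferential.D R (Unitization R A) (s.snd : Unitization R A) := by
        conv_lhs => rw [← Unitization.inl_fst_add_inr_snd_eq s, map_add,
          ← Unitization.algebraMap_eq_inl, Derivation.map_algebraMap, zero_add]
      rw [hs, hD _ (by simp [RingHom.mem_ker]) n hn, Derivation.liftKaehlerDifferential_comp_D]
    | zero => simp
    | add x y _ _ hx hy => simp only [map_add, hx, hy]
    | smul s x _ hx => rw [φ.phi_smul n hn, map_smul, map_smul, ψ.phi_smul n hn, hx]
  · ext s
    simp [hg.1]
end

section
/- Let S be a commutative ring, I an ideal of S, hI : DividedPowers I a divided power structure, M an S-module, and φ a DP-module family on M. Consider the trivial square-zero extension TrivSqZeroExt S M (a commutative ring) and its ideal 𝕀 = {(s, x) : s ∈ I, x ∈ M}. Define D : ℕ → TrivSqZeroExt S M → TrivSqZeroExt S M by D n z = 0 if z ∉ 𝕀; D 0 z = 1 if z ∈ 𝕀; and for n ≥ 1 and (s, x) ∈ 𝕀: D n (s, x) = (hI.dpow n s, φ n x + ∑_{i=1}^{n-1} (hI.dpow i s) • φ (n-i) x). Then D is a divided power structure (DividedPowers 𝕀) on the ideal 𝕀. -/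
/-- The ideal `{(s, x) : s ∈ I, x ∈ M}` of the trivial square-zero extension. -/
def TrivSqZeroExt.dpIdeal (S : Type*) [CommRing S] (M : Type*) [AddCommGroup M]
    [Module S M] [Module Sᵐᵒᵖ M] [IsCentralScalar S M] (I : Ideal S) :
    Ideal (TrivSqZeroExt S M) where
  carrier := {z | z.fst ∈ I}
  add_mem' := by
    intro z w hz hw
    simp only [Set.mem_setOf_eq, TrivSqZeroExt.fst_add] at *; exact I.add_mem hz hw
  zero_mem' := by simpa using I.zero_mem
  smul_mem' := by
    intro c z hz
    simpa [smul_eq_mul, TrivSqZeroExt.fst_mul] using I.mul_mem_left c.fst hz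

section

open Finset Polynomial TrivSqZeroExt

variable {S : Type*} [CommRing S] {M : Type*} [AddCommGroup M] [Module S M]

namespace DPModuleFamily

variable (φ : DPModuleFamily S M)

/-- The divided powers `x ↦ φ n x` on the square-zero ideal `M` of `TrivSqZeroExt S M`,
extended by `1` in degree zero. -/
def dpowInr (n : ℕ) (x : M) : TrivSqZeroExt S M :=
  if n = 0 then 1 else inr (φ.phi n x)

@[simp]
lemma dpowInr_zero (x : M) : φ.dpowInr 0 x = 1 := rfl

lemma dpowInr_of_ne_zero {n : ℕ} (hn : n ≠ 0) (x : M) : φ.dpowInr n x = inr (φ.phi n x) :=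
  if_neg hn

lemma dpowInr_apply_zero {n : ℕ} (hn : n ≠ 0) : φ.dpowInr n 0 = 0 := by
  simp [φ.dpowInr_of_ne_zero hn]

lemma factorial_smul_phi {n : ℕ} (hn : 2 ≤ n) (x : M) : n.factorial • φ.phi n x = 0 := by
  obtain ⟨k, rfl⟩ := Nat.exists_eq_add_of_le hn
  have h := φ.choose_smul_phi 1 (k + 1) le_rfl (by omega) x
  rw [show 1 + (k + 1) = 2 + k by ring, Nat.choose_one_right] at h
  rw [show 2 + k = (k + 1) + 1 by ring, Nat.factorial_succ, mul_comm, mul_smul,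
    show (k + 1) + 1 = 2 + k by ring, h, smul_zero]

variable [Module Sᵐᵒᵖ M]

lemma dpowInr_add (n : ℕ) (x y : M) :
    φ.dpowInr n (x + y) = ∑ p ∈ antidiagonal n, φ.dpowInr p.1 x * φ.dpowInr p.2 y := by
  rcases n with _ | n
  · simp
  rcases n with _ | n
  · simp [dpowInr_of_ne_zero, Finset.Nat.antidiagonal_succ, add_comm]
  · rw [Finset.Nat.sum_antidiagonal_succ, Finset.Nat.sum_antidiagonal_succ']
    simp [dpowInr_of_ne_zero, add_comm]

lemma dpowInr_mul_dpowInr (m n : ℕ) (x : M) :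
    φ.dpowInr m x * φ.dpowInr n x = ((m + n).choose m : ℕ) * φ.dpowInr (m + n) x := by
  rcases Nat.eq_zero_or_pos m with rfl | hm
  · simp
  rcases Nat.eq_zero_or_pos n with rfl | hn
  · simp
  rw [← nsmul_eq_mul, dpowInr_of_ne_zero _ hm.ne', dpowInr_of_ne_zero _ hn.ne',
    dpowInr_of_ne_zero _ (by omega), inr_mul_inr, ← inr_smul, φ.choose_smul_phi m n hm hn,
    inr_zero]

lemma dpowInr_smul (n : ℕ) (s : S) (x : M) :
    φ.dpowInr n (s • x) = inl (s ^ n) * φ.dpowInr n x := by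
  rcases Nat.eq_zero_or_pos n with rfl | hn
  · simp
  rw [dpowInr_of_ne_zero _ hn.ne', dpowInr_of_ne_zero _ hn.ne', φ.phi_smul n hn, inl_mul_inr]

lemma dpowInr_comp (m : ℕ) {n : ℕ} (hn : n ≠ 0) (x : M) :
    φ.dpowInr m (φ.phi n x) = (Nat.uniformBell m n : ℕ) * φ.dpowInr (m * n) x := by
  rcases Nat.eq_zero_or_pos m with rfl | hm
  · simp [Nat.uniformBell_zero_left]
  rw [← nsmul_eq_mul, dpowInr_of_ne_zero _ hm.ne', dpowInr_of_ne_zero _ (by positivity),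
    φ.phi_comp m n hm (Nat.pos_of_ne_zero hn), inr_smul]

end DPModuleFamily

namespace TrivSqZeroExt

variable [Module Sᵐᵒᵖ M] [IsCentralScalar S M] {I : Ideal S} (hI : DividedPowers I)
  (φ : DPModuleFamily S M)

lemma mem_dpIdeal {z : TrivSqZeroExt S M} : z ∈ dpIdeal S M I ↔ z.fst ∈ I := Iff.rfl

/-- The divided powers on `TrivSqZeroExt.dpIdeal`, as a convolution of the divided powers
on its two summands. -/
def dpowConv (n : ℕ) (z : TrivSqZeroExt S M) : TrivSqZeroExt S M :=
  ∑ p ∈ antidiagonal n, inl (hI.dpow p.1 z.fst) * φ.dpowInr p.2 z.snd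

variable {hI φ}

lemma dpowConv_zero {z : TrivSqZeroExt S M} (hz : z ∈ dpIdeal S M I) :
    dpowConv hI φ 0 z = 1 := by
  simp [dpowConv, hI.dpow_zero (mem_dpIdeal.1 hz)]

lemma dpowConv_eq {n : ℕ} (hn : n ≠ 0) {z : TrivSqZeroExt S M} (hz : z ∈ dpIdeal S M I) :
    dpowConv hI φ n z = inl (hI.dpow n z.fst) + inr (φ.phi n z.snd +
      ∑ i ∈ Finset.Ico 1 n, hI.dpow i z.fst • φ.phi (n - i) z.snd) := by
  rw [dpowConv, Finset.Nat.sum_antidiagonal_eq_sum_range_succ_mk, sum_range_succ, Nat.sub_self,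
    DPModuleFamily.dpowInr_zero, mul_one, add_comm]
  rw [range_eq_Ico, sum_eq_sum_Ico_succ_bot (Nat.pos_of_ne_zero hn), inr_add, inr_sum]
  congr 2
  · simp [hI.dpow_zero (mem_dpIdeal.1 hz), φ.dpowInr_of_ne_zero hn]
  · refine sum_congr rfl fun i hi ↦ ?_
    rw [φ.dpowInr_of_ne_zero (by grind), inl_mul_inr]

lemma fst_dpowConv (n : ℕ) {z : TrivSqZeroExt S M} (hz : z ∈ dpIdeal S M I) :
    (dpowConv hI φ n z).fst = hI.dpow n z.fst := by
  rcases eq_or_ne n 0 with rfl | hn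
  · simp [dpowConv_zero hz, hI.dpow_zero (mem_dpIdeal.1 hz)]
  · simp [dpowConv_eq hn hz]

lemma dpowConv_one {z : TrivSqZeroExt S M} (hz : z ∈ dpIdeal S M I) :
    dpowConv hI φ 1 z = z := by
  rw [dpowConv_eq one_ne_zero hz]
  simp [hI.dpow_one (mem_dpIdeal.1 hz), φ.phi_one, inl_fst_add_inr_snd_eq]

lemma dpowConv_mem {n : ℕ} (hn : n ≠ 0) {z : TrivSqZeroExt S M} (hz : z ∈ dpIdeal S M I) :
    dpowConv hI φ n z ∈ dpIdeal S M I := by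
  rw [dpowConv_eq hn hz, mem_dpIdeal]
  simpa using hI.dpow_mem hn hz

lemma inl_mem_dpIdeal {s : S} (hs : s ∈ I) : (inl s : TrivSqZeroExt S M) ∈ dpIdeal S M I := hs

lemma inr_mem_dpIdeal (x : M) : (inr x : TrivSqZeroExt S M) ∈ dpIdeal S M I := I.zero_mem

lemma dpowConv_inl (n : ℕ) (s : S) :
    dpowConv hI φ n (inl s) = inl (hI.dpow n s) := by
  rw [dpowConv, sum_eq_single (n, 0)]
  · simp
  · rintro ⟨i, j⟩ hij hne
    rw [snd_inl, φ.dpowInr_apply_zero (by grind [HasAntidiagonal.mem_antidiagonal]), mul_zero]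
  · simp

lemma dpowConv_inr (n : ℕ) (x : M) : dpowConv hI φ n (inr x) = φ.dpowInr n x := by
  rw [dpowConv, sum_eq_single (0, n)]
  · simp [hI.dpow_zero I.zero_mem]
  · rintro ⟨i, j⟩ hij hne
    rw [fst_inr, hI.dpow_eval_zero (by grind [HasAntidiagonal.mem_antidiagonal]), inl_zero, zero_mul]
  · simp

lemma dpowConv_add (n : ℕ) {z w : TrivSqZeroExt S M} (hz : z ∈ dpIdeal S M I)
    (hw : w ∈ dpIdeal S M I) :
    dpowConv hI φ n (z + w) =
      ∑ p ∈ antidiagonal n, dpowConv hI φ p.1 z * dpowConv hI φ p.2 w := by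
  have key (z : TrivSqZeroExt S M) : PowerSeries.mk (fun n ↦ dpowConv hI φ n z) =
      PowerSeries.map (inlHom S M) (hI.exp z.fst) *
        PowerSeries.mk (fun n ↦ φ.dpowInr n z.snd) := by
    ext1 n
    simp [PowerSeries.coeff_mul, dpowConv, DividedPowers.exp]
  have hadd : PowerSeries.mk (fun n ↦ φ.dpowInr n (z.snd + w.snd)) =
      PowerSeries.mk (fun n ↦ φ.dpowInr n z.snd) * PowerSeries.mk (fun n ↦ φ.dpowInr n w.snd) := by
    ext1 n
    simp [PowerSeries.coeff_mul, φ.dpowInr_add]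
  have h := key (z + w)
  rw [fst_add, snd_add, hI.exp_add hz hw, hadd, map_mul, mul_mul_mul_comm, ← key, ← key] at h
  simpa [PowerSeries.coeff_mul] using congr_arg (PowerSeries.coeff n) h

lemma dpowConv_inl_mul (n : ℕ) (r : S) {z : TrivSqZeroExt S M} (hz : z ∈ dpIdeal S M I) :
    dpowConv hI φ n (inl r * z) = inl r ^ n * dpowConv hI φ n z := by
  rw [dpowConv, dpowConv, mul_sum]
  refine sum_congr rfl fun p hp ↦ ?_
  rw [← mem_antidiagonal.1 hp, fst_mul, fst_inl, hI.dpow_mul hz, snd_mul, fst_inl, snd_inl,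
    smul_zero, add_zero, φ.dpowInr_smul, inl_mul, inl_pow, pow_add, inl_mul]
  ring

include hI in
omit [Module Sᵐᵒᵖ M] [IsCentralScalar S M] in
lemma dpowInr_smul_of_two_le {n : ℕ} (hn : 2 ≤ n) {s : S} (hs : s ∈ I) (x : M) :
    φ.dpowInr n (s • x) = 0 := by
  rw [φ.dpowInr_of_ne_zero (by omega), φ.phi_smul n (by omega),
    ← hI.factorial_mul_dpow_eq_pow hs, mul_comm, mul_smul, Nat.cast_smul_eq_nsmul,
    φ.factorial_smul_phi hn, smul_zero, inr_zero]

lemma dpowConv_mul (n : ℕ) (a : TrivSqZeroExt S M) {z : TrivSqZeroExt S M}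
    (hz : z ∈ dpIdeal S M I) :
    dpowConv hI φ n (a * z) = a ^ n * dpowConv hI φ n z := by
  rcases n with _ | n
  · rw [dpowConv_zero hz, dpowConv_zero (Ideal.mul_mem_left _ _ hz), pow_zero, one_mul]
  have hz' : z.fst ∈ I := hz
  have hsplit : a * z = inl a.fst * z + inr (z.fst • a.snd) := by
    ext <;> simp
  rw [hsplit, dpowConv_add _ (Ideal.mul_mem_left _ _ hz) (inr_mem_dpIdeal _),
    Finset.Nat.sum_antidiagonal_succ', sum_eq_single (n, 0)]
  · simp only [dpowConv_inl_mul _ _ hz, dpowConv_inr, zero_add]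
    rw [φ.dpowInr_zero, φ.dpowInr_of_ne_zero one_ne_zero, φ.phi_one]
    have hpow : z.fst * hI.dpow n z.fst = (n + 1) * hI.dpow (n + 1) z.fst := by
      simpa [hI.dpow_one hz', add_comm 1 n] using hI.mul_dpow (m := 1) (n := n) hz'
    have hfst (k : ℕ) : (dpowConv hI φ k z).fst = hI.dpow k z.fst := fst_dpowConv k hz
    ext
    · simp
    · suffices z.fst • (a.fst ^ n * hI.dpow n z.fst) • a.snd =
          hI.dpow (n + 1) z.fst • (n + 1) • a.fst ^ n • a.snd by simpa [hfst, snd_pow]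
      rw [← Nat.cast_smul_eq_nsmul S (n + 1), smul_smul, smul_smul, smul_smul,
        mul_left_comm, hpow]
      congr 1
      push_cast
      ring
  · rintro ⟨i, j⟩ hij hne
    rw [dpowConv_inr, dpowInr_smul_of_two_le (hI := hI) (by grind [HasAntidiagonal.mem_antidiagonal]) hz', mul_zero]
  · simp

/-- The canonical divided powers on a polynomial ring in two variables over `ℚ`. -/
noncomputable def ratPolyDividedPowers : DividedPowers (⊤ : Ideal ℚ[X][X]) :=
  open scoped Classical in DividedPowers.RatAlgebra.dividedPowers ⊤

lemma ratPolyDividedPowers_mul (i j : ℕ) :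
    ratPolyDividedPowers.dpow i (C X) * ratPolyDividedPowers.dpow j X =
      monomial j (monomial i ((i.factorial : ℚ)⁻¹ * (j.factorial : ℚ)⁻¹)) := by
  have h (n : ℕ) (q : ℚ[X][X]) :
      ratPolyDividedPowers.dpow n q = C (C (n.factorial : ℚ)⁻¹) * q ^ n := by
    rw [DividedPowers.RatAlgebra.dpow_eq_inv_fact_smul _ _ Submodule.mem_top,
      Ring.inverse_eq_inv', Algebra.smul_def]
    rfl
  rw [h, h, ← C_mul_X_pow_eq_monomial, ← C_mul_X_pow_eq_monomial]
  simp only [map_mul, map_pow]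
  ring

variable (hI φ) in
/-- The products of divided powers of the two components of `z`, paired with the
corresponding products of divided powers of two independent variables over `ℚ`. -/
noncomputable def dpowPair (z : TrivSqZeroExt S M) (p : ℕ × ℕ) : TrivSqZeroExt S M × ℚ[X][X] :=
  (inl (hI.dpow p.1 z.fst) * φ.dpowInr p.2 z.snd,
    ratPolyDividedPowers.dpow p.1 (C X) * ratPolyDividedPowers.dpow p.2 X)

lemma dpowPair_mul {z : TrivSqZeroExt S M} (hz : z ∈ dpIdeal S M I) (p q : ℕ × ℕ) :
    dpowPair hI φ z p * dpowPair hI φ z q =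
      ((p.1 + q.1).choose p.1 * (p.2 + q.2).choose p.2) • dpowPair hI φ z (p + q) := by
  ext1
  · simp only [dpowPair, Prod.fst_mul, Prod.smul_fst, Prod.fst_add, Prod.snd_add]
    rw [nsmul_eq_mul, mul_mul_mul_comm, inl_mul_inl, hI.mul_dpow hz, φ.dpowInr_mul_dpowInr, inl_mul,
      inl_natCast]
    push_cast
    ring
  · simp only [dpowPair, Prod.snd_mul, Prod.smul_snd, Prod.fst_add, Prod.snd_add]
    rw [nsmul_eq_mul, mul_mul_mul_comm, ratPolyDividedPowers.mul_dpow trivial,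
      ratPolyDividedPowers.mul_dpow trivial]
    push_cast
    ring

variable (φ) in
/-- The graph of the correspondence between polynomial expressions in the divided powers of
the components of `z` and polynomials over `ℚ`. -/
noncomputable def dpowGraph {z : TrivSqZeroExt S M} (hz : z ∈ dpIdeal S M I) :
    Subsemiring (TrivSqZeroExt S M × ℚ[X][X]) where
  __ := (Submodule.span ℕ (Set.range (dpowPair hI φ z))).toAddSubmonoid
  one_mem' := by
    refine Submodule.subset_span ⟨0, ?_⟩
    simp [dpowPair, hI.dpow_zero (mem_dpIdeal.1 hz), ratPolyDividedPowers.dpow_zero]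
  mul_mem' {a b} ha hb := by
    have h : Submodule.span ℕ (Set.range (dpowPair hI φ z)) *
        Submodule.span ℕ (Set.range (dpowPair hI φ z)) ≤
        Submodule.span ℕ (Set.range (dpowPair hI φ z)) := by
      rw [Submodule.span_mul_span, Submodule.span_le]
      rintro _ ⟨_, ⟨p, rfl⟩, _, ⟨q, rfl⟩, rfl⟩
      simp only [dpowPair_mul hz]
      exact Submodule.smul_mem _ _ (Submodule.subset_span ⟨_, rfl⟩)
    exact h (Submodule.mul_mem_mul ha hb)

variable {z : TrivSqZeroExt S M} (hz : z ∈ dpIdeal S M I)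

lemma dpowPair_mem_dpowGraph (p : ℕ × ℕ) : dpowPair hI φ z p ∈ dpowGraph φ (hI := hI) hz :=
  Submodule.subset_span ⟨p, rfl⟩

include hz in
/-- The graph is single-valued over the polynomial ring. -/
lemma eq_of_mem_dpowGraph {a b : TrivSqZeroExt S M} {q : ℚ[X][X]}
    (ha : (a, q) ∈ dpowGraph φ (hI := hI) hz) (hb : (b, q) ∈ dpowGraph φ (hI := hI) hz) :
    a = b := by
  have hcoeff (u : ℕ × ℕ →₀ ℕ) (i j : ℕ) :
      ((Finsupp.linearCombination ℕ (dpowPair hI φ z) u).2.coeff j).coeff i =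
        u (i, j) * ((i.factorial : ℚ)⁻¹ * (j.factorial : ℚ)⁻¹) := by
    induction u using Finsupp.induction_linear with
    | zero => simp
    | add u v hu hv => simp [hu, hv, add_mul]
    | single p n =>
      obtain ⟨k, l⟩ := p
      rw [Finsupp.linearCombination_single, Prod.smul_snd, coeff_smul, coeff_smul, nsmul_eq_mul,
        dpowPair, ratPolyDividedPowers_mul, coeff_monomial, Finsupp.single_apply]
      by_cases hl : l = j <;> by_cases hk : k = i <;> simp [coeff_monomial, hl, hk]
  obtain ⟨u, hu⟩ := (Finsupp.mem_span_range_iff_exists_finsupp (R := ℕ)).1 ha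
  obtain ⟨v, hv⟩ := (Finsupp.mem_span_range_iff_exists_finsupp (R := ℕ)).1 hb
  rw [← Finsupp.linearCombination_apply] at hu hv
  have huv : u = v := by
    ext ⟨i, j⟩
    have h := (hcoeff u i j).symm.trans ((by rw [hu, hv]) : _ = _) |>.trans (hcoeff v i j)
    have hne : (i.factorial : ℚ)⁻¹ * (j.factorial : ℚ)⁻¹ ≠ 0 := by positivity
    exact_mod_cast mul_right_cancel₀ hne h
  rw [huv, hv] at hu
  exact congr_arg Prod.fst hu.symm

lemma dpowConv_pair_mem_dpowGraph (n : ℕ) :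
    (dpowConv hI φ n z, ratPolyDividedPowers.dpow n (C X + X)) ∈ dpowGraph φ (hI := hI) hz := by
  have h : (dpowConv hI φ n z, ratPolyDividedPowers.dpow n (C X + X)) =
      ∑ p ∈ antidiagonal n, dpowPair hI φ z p := by
    ext1
    · simp [dpowConv, dpowPair, Prod.fst_sum]
    · simp only [dpowPair, Prod.snd_sum, ratPolyDividedPowers.dpow_add trivial trivial]
  rw [h]
  exact sum_mem fun p _ ↦ dpowPair_mem_dpowGraph hz p

lemma dpowConv_dpowPair_mem_dpowGraph (m : ℕ) {p : ℕ × ℕ} (hp : p.1 + p.2 ≠ 0) :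
    (dpowPair hI φ z p).1 ∈ dpIdeal S M I ∧
      (dpowConv hI φ m (dpowPair hI φ z p).1,
        ratPolyDividedPowers.dpow m (dpowPair hI φ z p).2) ∈ dpowGraph φ (hI := hI) hz := by
  obtain ⟨i, j⟩ := p
  have hi1 := dpowPair_mem_dpowGraph (hI := hI) (φ := φ) hz (i, 0)
  simp only [dpowPair, DPModuleFamily.dpowInr_zero, mul_one,
    ratPolyDividedPowers.dpow_zero trivial] at hi1 ⊢
  rcases eq_or_ne j 0 with rfl | hj
  · have hi : i ≠ 0 := by simpa using hp
    have h := mul_mem (natCast_mem (dpowGraph φ (hI := hI) hz) (Nat.uniformBell m i))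
      (dpowPair_mem_dpowGraph (hI := hI) (φ := φ) hz (m * i, 0))
    refine ⟨by simpa using inl_mem_dpIdeal (hI.dpow_mem hi hz), ?_⟩
    convert h using 1
    ext1
    · simp [dpowPair, dpowConv_inl, hI.dpow_comp hi hz]
    · simp [dpowPair, ratPolyDividedPowers.dpow_zero, ratPolyDividedPowers.dpow_comp hi]
  · have h := mul_mem (pow_mem hi1 m)
      (mul_mem (natCast_mem (dpowGraph φ (hI := hI) hz) (Nat.uniformBell m j))
        (dpowPair_mem_dpowGraph (hI := hI) (φ := φ) hz (0, m * j)))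
    rw [φ.dpowInr_of_ne_zero hj]
    refine ⟨Ideal.mul_mem_left _ _ (inr_mem_dpIdeal _), ?_⟩
    convert h using 1
    ext1
    · simp [dpowPair, dpowConv_inl_mul _ _ (inr_mem_dpIdeal _), dpowConv_inr, φ.dpowInr_comp m hj,
        hI.dpow_zero (mem_dpIdeal.1 hz)]
    · simp [dpowPair, ratPolyDividedPowers.dpow_zero, ratPolyDividedPowers.dpow_comp hj,
        ratPolyDividedPowers.dpow_mul]

lemma dpowConv_comp_mem_dpowGraph (m : ℕ) {n : ℕ} (hn : n ≠ 0) :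
    (dpowConv hI φ m (dpowConv hI φ n z), ratPolyDividedPowers.dpow m
      (ratPolyDividedPowers.dpow n (C X + X))) ∈ dpowGraph φ (hI := hI) hz := by
  rw [ratPolyDividedPowers.dpow_add trivial trivial]
  let P (a : TrivSqZeroExt S M × ℚ[X][X]) : Prop := a.1 ∈ dpIdeal S M I ∧
    ∀ m, (dpowConv hI φ m a.1, ratPolyDividedPowers.dpow m a.2) ∈ dpowGraph φ (hI := hI) hz
  have h : P (∑ p ∈ antidiagonal n, dpowPair hI φ z p) := by
    refine sum_induction _ P (fun a b ha hb ↦ ⟨add_mem ha.1 hb.1, fun m ↦ ?_⟩) ⟨zero_mem _, ?_⟩ ?_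
    · have h := sum_mem (t := antidiagonal m) fun p _ ↦ mul_mem (ha.2 p.1) (hb.2 p.2)
      convert h using 1
      ext1
      · simp [Prod.fst_sum, dpowConv_add _ ha.1 hb.1]
      · simp [Prod.snd_sum, ratPolyDividedPowers.dpow_add]
    · intro m
      rcases eq_or_ne m 0 with rfl | hm
      · rw [Prod.fst_zero, Prod.snd_zero, dpowConv_zero (zero_mem _), ratPolyDividedPowers.dpow_zero trivial]
        exact one_mem _
      · have h0 : dpowConv hI φ m 0 = 0 := by
          rw [← inr_zero, dpowConv_inr, φ.dpowInr_apply_zero hm, inr_zero]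
        rw [Prod.fst_zero, Prod.snd_zero, h0, ratPolyDividedPowers.dpow_eval_zero hm]
        exact zero_mem _
    · intro p hp
      have hp' : p.1 + p.2 ≠ 0 := by rwa [mem_antidiagonal.1 hp]
      exact ⟨(dpowConv_dpowPair_mem_dpowGraph hz 0 hp').1,
        fun m ↦ (dpowConv_dpowPair_mem_dpowGraph hz m hp').2⟩
  simpa [Prod.fst_sum, Prod.snd_sum, dpowPair, dpowConv] using h.2 m

include hz

lemma dpowConv_mul_dpowConv (m n : ℕ) :
    dpowConv hI φ m z * dpowConv hI φ n z = ((m + n).choose m : ℕ) * dpowConv hI φ (m + n) z := by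
  have h := mul_mem (dpowConv_pair_mem_dpowGraph (hI := hI) (φ := φ) hz m)
    (dpowConv_pair_mem_dpowGraph hz n)
  rw [Prod.mk_mul_mk, ratPolyDividedPowers.mul_dpow trivial] at h
  exact eq_of_mem_dpowGraph hz h (mul_mem (natCast_mem _ ((m + n).choose m))
    (dpowConv_pair_mem_dpowGraph hz (m + n)))

lemma dpowConv_comp (m : ℕ) {n : ℕ} (hn : n ≠ 0) :
    dpowConv hI φ m (dpowConv hI φ n z) =
      (Nat.uniformBell m n : ℕ) * dpowConv hI φ (m * n) z := by
  have h := dpowConv_comp_mem_dpowGraph (hI := hI) (φ := φ) hz m hn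
  rw [ratPolyDividedPowers.dpow_comp hn trivial] at h
  exact eq_of_mem_dpowGraph hz h (mul_mem (natCast_mem _ (Nat.uniformBell m n))
    (dpowConv_pair_mem_dpowGraph hz (m * n)))

end TrivSqZeroExt

end


/-- the divided power structure on the trivial square-zero extension
`TrivSqZeroExt S M` induced by a divided power structure on `I ⊆ S` and a divided power
module family on `M`. -/
theorem exists_dividedPowers_trivSqZeroExt {S : Type*} [CommRing S]
    {M : Type*} [AddCommGroup M] [Module S M] [Module Sᵐᵒᵖ M] [IsCentralScalar S M]
    {I : Ideal S} (hI : DividedPowers I) (φ : DPModuleFamily S M)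
    (D : ℕ → TrivSqZeroExt S M → TrivSqZeroExt S M)
    (hD_null : ∀ (n : ℕ) (z : TrivSqZeroExt S M),
      z ∉ TrivSqZeroExt.dpIdeal S M I → D n z = 0)
    (hD_zero : ∀ z ∈ TrivSqZeroExt.dpIdeal S M I, D 0 z = 1)
    (hD_pos : ∀ n : ℕ, 1 ≤ n → ∀ z ∈ TrivSqZeroExt.dpIdeal S M I,
      D n z = TrivSqZeroExt.inl (hI.dpow n z.fst) +
        TrivSqZeroExt.inr (φ.phi n z.snd +
          ∑ i ∈ Finset.Ico 1 n, hI.dpow i z.fst • φ.phi (n - i) z.snd)) :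
    ∃ hD : DividedPowers (TrivSqZeroExt.dpIdeal S M I), hD.dpow = D := by
  have hD (n : ℕ) {z : TrivSqZeroExt S M} (hz : z ∈ TrivSqZeroExt.dpIdeal S M I) :
      D n z = TrivSqZeroExt.dpowConv hI φ n z := by
    rcases Nat.eq_zero_or_pos n with rfl | hn
    · rw [hD_zero z hz, TrivSqZeroExt.dpowConv_zero hz]
    · rw [hD_pos n hn z hz, TrivSqZeroExt.dpowConv_eq hn.ne' hz]
  exact ⟨{
    dpow := D
    dpow_null := fun hz ↦ hD_null _ _ hz
    dpow_zero := fun hz ↦ hD_zero _ hz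
    dpow_one := fun hz ↦ by rw [hD _ hz, TrivSqZeroExt.dpowConv_one hz]
    dpow_mem := fun hn hz ↦ by
      rw [hD _ hz]
      exact TrivSqZeroExt.dpowConv_mem hn hz
    dpow_add := fun hz hw ↦ by
      simp only [hD _ (add_mem hz hw), hD _ hz, hD _ hw, TrivSqZeroExt.dpowConv_add _ hz hw]
    dpow_mul := fun hz ↦ by
      rw [hD _ (Ideal.mul_mem_left _ _ hz), hD _ hz, TrivSqZeroExt.dpowConv_mul _ _ hz]
    mul_dpow := fun hz ↦ by
      simp only [hD _ hz, TrivSqZeroExt.dpowConv_mul_dpowConv hz]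
    dpow_comp := fun hn hz ↦ by
      rw [hD _ hz, hD _ hz, hD _ (TrivSqZeroExt.dpowConv_mem hn hz),
        TrivSqZeroExt.dpowConv_comp hz _ hn] }, rfl⟩
end

section
/- Let S be a commutative ring, I an ideal of S with I * I = 0 (i.e. x * y = 0 for all x, y ∈ I), and hI : DividedPowers I a divided power structure. If n ≥ 2 is not a prime power (that is, n is not of the form p^e for a prime p and e ≥ 1), then hI.dpow n a = 0 for every a ∈ I. -/
/-- If `I * I = 0` and `n ≥ 2` is not a prime power, then `dpow n a = 0`
for all `a ∈ I`. -/
theorem dpow_eq_zero_of_not_isPrimePow {S : Type*} [CommRing S] {I : Ideal S}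
    (hsq : ∀ x ∈ I, ∀ y ∈ I, x * y = 0) (hI : DividedPowers I)
    {n : ℕ} (hn : 2 ≤ n) (hnp : ¬ IsPrimePow n) :
    ∀ a ∈ I, hI.dpow n a = 0 := by
  intro a ha
  have hdvd : addOrderOf (hI.dpow n a) ∣ (Finset.Icc 1 (n - 1)).gcd n.choose := by
    refine Finset.dvd_gcd fun i hi ↦ ?_
    obtain ⟨hi₁, hi₂⟩ := Finset.mem_Icc.mp hi
    have hmul := hI.mul_dpow (m := i) (n := n - i) ha
    rw [hsq _ (hI.dpow_mem (by lia) ha) _ (hI.dpow_mem (by lia) ha),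
      Nat.add_sub_cancel' (by lia)] at hmul
    rw [addOrderOf_dvd_iff_nsmul_eq_zero, nsmul_eq_mul, ← hmul]
  rwa [Choose.gcd_choose_eq_one_of_not_isPrimePow hn hnp, Nat.dvd_one,
    AddMonoid.addOrderOf_eq_one_iff] at hdvd
end

section
/- Let S be a commutative ring, I an ideal of S with I * I = 0, and hI : DividedPowers I a divided power structure. Then for every prime p, every e ≥ 1, and every a ∈ I, one has p • hI.dpow (p^e) a = 0. -/
/-- If any two elements of `I` have product zero, then `(m + n).choose m` kills `dpow (m + n) a`
for positive `m` and `n`. -/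
theorem DividedPowers.choose_smul_dpow_add_eq_zero {S : Type*} [CommRing S] {I : Ideal S}
    (hsq : ∀ x ∈ I, ∀ y ∈ I, x * y = 0) (hI : DividedPowers I) {m n : ℕ} (hm : m ≠ 0)
    (hn : n ≠ 0) {a : S} (ha : a ∈ I) : (m + n).choose m • hI.dpow (m + n) a = 0 := by
  rw [nsmul_eq_mul, ← hI.mul_dpow ha]
  exact hsq _ (hI.dpow_mem hm ha) _ (hI.dpow_mem hn ha)

/-- A common divisor of `p ^ (n + 1)` and `(p ^ (n + 1)).choose (p ^ n)` divides `p`. -/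
theorem Nat.Prime.dvd_of_dvd_pow_of_dvd_choose {p n d : ℕ} (hp : p.Prime)
    (hpow : d ∣ p ^ (n + 1)) (hchoose : d ∣ (p ^ (n + 1)).choose (p ^ n)) : d ∣ p := by
  have hle : p ^ n ≤ p ^ (n + 1) := Nat.pow_le_pow_right hp.pos n.le_succ
  obtain ⟨j, -, rfl⟩ := (Nat.dvd_prime_pow hp).1 hpow
  have hj := (hp.pow_dvd_iff_le_factorization (Nat.choose_pos hle).ne').1 hchoose
  rw [Nat.factorization_choose_prime_pow hp hle (pow_ne_zero n hp.ne_zero),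
    hp.factorization_pow, Finsupp.single_eq_same, Nat.add_sub_cancel_left] at hj
  simpa using pow_dvd_pow p hj

/-- If `I * I = 0`, then `p • dpow (p^e) a = 0` for every prime `p`,
every `e ≥ 1`, and every `a ∈ I`. -/
theorem smul_dpow_prime_pow_eq_zero {S : Type*} [CommRing S] {I : Ideal S}
    (hsq : ∀ x ∈ I, ∀ y ∈ I, x * y = 0) (hI : DividedPowers I) :
    ∀ p : ℕ, p.Prime → ∀ e : ℕ, 1 ≤ e → ∀ a ∈ I, p • hI.dpow (p ^ e) a = 0 := by
  intro p hp e he a ha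
  obtain ⟨n, rfl⟩ := Nat.exists_eq_add_of_le' he
  have hchoose {k : ℕ} (hk : k ≠ 0) (hlt : k < p ^ (n + 1)) :
      addOrderOf (hI.dpow (p ^ (n + 1)) a) ∣ (p ^ (n + 1)).choose k := by
    have h := hI.choose_smul_dpow_add_eq_zero hsq hk (Nat.sub_ne_zero_of_lt hlt) ha
    rw [Nat.add_sub_cancel' hlt.le] at h
    exact addOrderOf_dvd_of_nsmul_eq_zero h
  refine addOrderOf_dvd_iff_nsmul_eq_zero.1 (hp.dvd_of_dvd_pow_of_dvd_choose (n := n) ?_ ?_)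
  · simpa using hchoose one_ne_zero (Nat.one_lt_pow n.succ_ne_zero hp.one_lt)
  · exact hchoose (pow_ne_zero n hp.ne_zero) (Nat.pow_lt_pow_right hp.one_lt n.lt_succ_self)
end

section
/- Let S be a commutative ring, I an ideal of S with I * I = 0, and hI : DividedPowers I a divided power structure. Then for every prime p, every e ≥ 1, and every a ∈ I, the divided power hI.dpow (p^e) a equals the e-fold iterate of hI.dpow p applied to a: hI.dpow (p^e) a = (hI.dpow p)^[e] a. -/
/-- The congruence of Lucas for the last `e` base-`p` digits when they are all equal to `p - 1`. -/
theorem choose_mul_prime_pow_add_sub_one_modEq {p : ℕ} (hp : p.Prime) (k e : ℕ) :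
    (k * p ^ e + p ^ e - 1).choose (p ^ e - 1) ≡ 1 [MOD p] := by
  have : Fact p.Prime := ⟨hp⟩
  have hp0 := hp.pos
  induction e with
  | zero => simp [Nat.ModEq.refl]
  | succ e ih =>
    have digit : ∀ m : ℕ, 0 < m → (m * p - 1) % p = p - 1 ∧ (m * p - 1) / p = m - 1 := by
      intro m hm
      obtain ⟨m, rfl⟩ := Nat.exists_eq_add_of_le' hm
      have h : (m + 1) * p - 1 = (p - 1) + p * m := by
        rw [add_mul, mul_comm m p]
        omega
      have hlt : p - 1 < p := by omega
      rw [h, Nat.add_mul_mod_self_left, Nat.mod_eq_of_lt hlt, Nat.add_mul_div_left _ _ hp0,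
        Nat.div_eq_of_lt hlt]
      simp
    have he : 0 < p ^ e := pow_pos hp0 e
    have key := Choose.choose_modEq_choose_mod_mul_choose_div_nat (p := p)
      (n := k * p ^ (e + 1) + p ^ (e + 1) - 1) (k := p ^ (e + 1) - 1)
    have h : k * p ^ (e + 1) + p ^ (e + 1) - 1 = (k * p ^ e + p ^ e) * p - 1 := by ring_nf
    rw [h, pow_succ, (digit _ (by omega)).1, (digit _ (by omega)).2, (digit _ he).1,
      (digit _ he).2, Nat.choose_self, one_mul] at key
    rw [h, pow_succ]
    exact key.trans ih

theorem uniformBell_prime_pow_modEq_one {p : ℕ} (hp : p.Prime) (m e : ℕ) :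
    Nat.uniformBell m (p ^ e) ≡ 1 [MOD p] := by
  induction m with
  | zero => rw [Nat.uniformBell_zero_left]
  | succ m ih =>
    rw [Nat.uniformBell_succ_left]
    simpa using (choose_mul_prime_pow_add_sub_one_modEq hp m e).mul ih

/-- On an ideal of square zero, divided powers of order `p ^ (e + 1)` are killed by `p`. -/
theorem prime_nsmul_dpow_prime_pow_eq_zero {S : Type*} [CommRing S] {I : Ideal S}
    (hsq : ∀ x ∈ I, ∀ y ∈ I, x * y = 0) (hI : DividedPowers I) {p : ℕ} (hp : p.Prime) (e : ℕ)
    {a : S} (ha : a ∈ I) : p • hI.dpow (p ^ (e + 1)) a = 0 := by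
  have choose_nsmul : ∀ i j : ℕ, i ≠ 0 → j ≠ 0 →
      (i + j).choose i • hI.dpow (i + j) a = 0 := by
    intro i j hi hj
    rw [nsmul_eq_mul, ← hI.mul_dpow ha]
    exact hsq _ (hI.dpow_mem hi ha) _ (hI.dpow_mem hj ha)
  have he : p ^ e ≠ 0 := pow_ne_zero e hp.ne_zero
  have hlt : 1 < p ^ (e + 1) := Nat.one_lt_pow (by omega) hp.one_lt
  have h₁ : p ^ (e + 1) • hI.dpow (p ^ (e + 1)) a = 0 := by
    have h := choose_nsmul 1 (p ^ (e + 1) - 1) one_ne_zero (by omega)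
    rwa [Nat.add_sub_cancel' hlt.le, Nat.choose_one_right] at h
  obtain ⟨q, hq⟩ := Nat.exists_eq_add_of_le' hp.pos
  have hq0 : q ≠ 0 := by
    have := hp.one_lt
    omega
  set c := (q * p ^ e + p ^ e - 1).choose (p ^ e - 1) with hc
  have h₂ : (p * c) • hI.dpow (p ^ (e + 1)) a = 0 := by
    have h := choose_nsmul (p ^ e) (q * p ^ e) he (mul_ne_zero hq0 he)
    have hpow : p ^ e + q * p ^ e = p ^ (e + 1) := by
      rw [pow_succ]
      nth_rw 4 [hq]
      ring
    have hchoose : (p ^ e + q * p ^ e).choose (p ^ e) = p * c := by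
      rw [add_comm, Nat.choose_mul_add he, ← hq]
    rwa [hchoose, hpow] at h
  have hcop : Nat.Coprime c (p ^ e) := by
    refine Nat.Coprime.pow_right e ?_
    have h := (choose_mul_prime_pow_add_sub_one_modEq hp q e).gcd_eq
    rwa [Nat.gcd_one_left] at h
  have hdvd := Nat.dvd_gcd (addOrderOf_dvd_of_nsmul_eq_zero h₂)
    (addOrderOf_dvd_of_nsmul_eq_zero h₁)
  rw [pow_succ', Nat.gcd_mul_left, hcop, mul_one, ← pow_succ'] at hdvd
  exact addOrderOf_dvd_iff_nsmul_eq_zero.mp hdvd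

theorem dpow_prime_pow_succ {S : Type*} [CommRing S] {I : Ideal S}
    (hsq : ∀ x ∈ I, ∀ y ∈ I, x * y = 0) (hI : DividedPowers I) {p : ℕ} (hp : p.Prime) (e : ℕ)
    {a : S} (ha : a ∈ I) : hI.dpow (p ^ (e + 1)) a = hI.dpow p (hI.dpow (p ^ e) a) := by
  rw [hI.dpow_comp (pow_ne_zero e hp.ne_zero) ha, ← pow_succ', ← nsmul_eq_mul]
  have hmod : Nat.uniformBell p (p ^ e) ≡ 1 [MOD addOrderOf (hI.dpow (p ^ (e + 1)) a)] :=
    (uniformBell_prime_pow_modEq_one hp p e).of_dvd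
      (addOrderOf_dvd_of_nsmul_eq_zero (prime_nsmul_dpow_prime_pow_eq_zero hsq hI hp e ha))
  rw [nsmul_eq_nsmul_iff_modEq.mpr hmod, one_nsmul]

/-- If `I * I = 0`, then `dpow (p^e) a = (dpow p)^[e] a` for every prime `p`,
every `e ≥ 1`, and every `a ∈ I`. -/
theorem dpow_prime_pow_eq_iterate {S : Type*} [CommRing S] {I : Ideal S}
    (hsq : ∀ x ∈ I, ∀ y ∈ I, x * y = 0) (hI : DividedPowers I) :
    ∀ p : ℕ, p.Prime → ∀ e : ℕ, 1 ≤ e → ∀ a ∈ I,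
      hI.dpow (p ^ e) a = (hI.dpow p)^[e] a := by
  intro p hp e _ a ha
  clear * - hsq hp ha
  induction e with
  | zero => rw [pow_zero, hI.dpow_one ha, Function.iterate_zero_apply]
  | succ e ih => rw [dpow_prime_pow_succ hsq hI hp e ha, ih, Function.iterate_succ_apply']
end

section
/- For every commutative ring R and every R-module V, a free divided power algebra on V exists: there are a commutative R-algebra Γ, an ideal I_Γ ⊆ Γ, a divided power structure γ : DividedPowers I_Γ, and an R-linear map ι : V → I_Γ such that for every commutative R-algebra S, every ideal J ⊆ S equipped with a divided power structure δ, and every R-linear map f : V → J, there is a unique R-algebra homomorphism g : Γ → S with g ∘ ι = f, g(I_Γ) ⊆ J, and g (γ.dpow n x) = δ.dpow n (g x) for all x ∈ I_Γ and n ≥ 1. -/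
universe u v s

/-- The data of a free divided power algebra on an `R`-module `V`: a commutative
`R`-algebra `Γ`, an ideal `I_Γ`, a divided power structure `γ` on `I_Γ` and an `R`-linear
map `ι : V → I_Γ`, universal among `R`-linear maps from `V` into an ideal with divided
powers. -/
structure FreeDividedPowerAlgebra (R : Type u) [CommRing R] (V : Type v) [AddCommGroup V]
    [Module R V] where
  Γ : Type (max u v)
  [commRing : CommRing Γ]
  [algebra : Algebra R Γ]
  IΓ : Ideal Γ
  γ : DividedPowers IΓ
  ι : V →ₗ[R] Γ
  mem_ideal : ∀ v : V, ι v ∈ IΓ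
  universal : ∀ (S : Type s) [CommRing S] [Algebra R S] (J : Ideal S)
    (δ : DividedPowers J) (f : V →ₗ[R] S), (∀ v : V, f v ∈ J) →
    ∃! g : Γ →ₐ[R] S, (∀ v : V, g (ι v) = f v) ∧ (∀ x ∈ IΓ, g x ∈ J) ∧
      (∀ x ∈ IΓ, ∀ n : ℕ, 1 ≤ n → g (γ.dpow n x) = δ.dpow n (g x))

/-- The componentwise divided power structure on a product of ideals. -/
noncomputable def DividedPowers.pi {ι : Type*} {S : ι → Type*} [∀ i, CommRing (S i)]
    {J : ∀ i, Ideal (S i)} (δ : ∀ i, DividedPowers (J i)) : DividedPowers (Ideal.pi J) where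
  dpow n x := open scoped Classical in if x ∈ Ideal.pi J then fun i ↦ (δ i).dpow n (x i) else 0
  dpow_null hx := if_neg hx
  dpow_zero hx := by
    rw [if_pos hx]
    exact funext fun i ↦ (δ i).dpow_zero (hx i)
  dpow_one hx := by
    rw [if_pos hx]
    exact funext fun i ↦ (δ i).dpow_one (hx i)
  dpow_mem hn hx := by
    rw [if_pos hx]
    exact fun i ↦ (δ i).dpow_mem hn (hx i)
  dpow_add hx hy := by
    simp only [if_pos hx, if_pos hy, if_pos (add_mem hx hy)]
    funext i
    simpa using (δ i).dpow_add (hx i) (hy i)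
  dpow_mul {n a x} hx := by
    rw [if_pos hx, if_pos (Ideal.mul_mem_left _ a hx)]
    exact funext fun i ↦ (δ i).dpow_mul (hx i)
  mul_dpow hx := by
    simp only [if_pos hx]
    exact funext fun i ↦ (δ i).mul_dpow (hx i)
  dpow_comp {m n x} hn hx := by
    have h : (fun i ↦ (δ i).dpow n (x i)) ∈ Ideal.pi J := fun i ↦ (δ i).dpow_mem hn (hx i)
    rw [if_pos hx, if_pos h, if_pos hx]
    exact funext fun i ↦ (δ i).dpow_comp hn (hx i)

theorem DividedPowers.pi_dpow_apply {ι : Type*} {S : ι → Type*} [∀ i, CommRing (S i)]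
    {J : ∀ i, Ideal (S i)} (δ : ∀ i, DividedPowers (J i)) (n : ℕ) {x : ∀ i, S i}
    (hx : x ∈ Ideal.pi J) (i : ι) :
    (DividedPowers.pi δ).dpow n x i = (δ i).dpow n (x i) :=
  congrFun (if_pos hx) i

/-- The restriction of a divided power structure to a subalgebra stable under divided powers. -/
def DividedPowers.restrictSubalgebra {R A : Type*} [CommRing R] [CommRing A] [Algebra R A]
    {I : Ideal A} (hI : DividedPowers I) (D : Subalgebra R A)
    (hD : ∀ n, ∀ x ∈ D, hI.dpow n x ∈ D) : DividedPowers (I.comap D.val) where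
  dpow n x := ⟨hI.dpow n x, hD n x x.2⟩
  dpow_null hx := Subtype.ext (hI.dpow_null hx)
  dpow_zero hx := Subtype.ext (hI.dpow_zero hx)
  dpow_one hx := Subtype.ext (hI.dpow_one hx)
  dpow_mem hn hx := hI.dpow_mem hn hx
  dpow_add hx hy := Subtype.ext (by simpa using hI.dpow_add hx hy)
  dpow_mul hx := Subtype.ext (hI.dpow_mul hx)
  mul_dpow hx := Subtype.ext (hI.mul_dpow hx)
  dpow_comp hn hx := Subtype.ext (hI.dpow_comp hn hx)

namespace FreeDividedPowerAlgebra

/-- Formal expressions built from scalars in `R` and generators in `V` by ring operations and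
divided powers. -/
inductive Term (R : Type u) (V : Type v) : Type (max u v)
  | scalar (r : R)
  | gen (v : V)
  | add (s t : Term R V)
  | mul (s t : Term R V)
  | dpow (n : ℕ) (t : Term R V)

variable {R : Type u} [CommRing R] {V : Type v}

/-- The value of a formal expression in an algebra with divided powers. -/
def Term.eval {A : Type*} [CommRing A] [Algebra R A] {I : Ideal A} (hI : DividedPowers I)
    (f : V → A) : Term R V → A
  | scalar r => algebraMap R A r
  | gen v => f v
  | add s t => s.eval hI f + t.eval hI f
  | mul s t => s.eval hI f * t.eval hI f
  | dpow n t => hI.dpow n (t.eval hI f)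

/-- The smallest subalgebra that contains the image of `f` and is stable under divided powers. -/
def closure {A : Type*} [CommRing A] [Algebra R A] {I : Ideal A} (hI : DividedPowers I)
    (f : V → A) : Subalgebra R A where
  carrier := Set.range (Term.eval (R := R) hI f)
  mul_mem' := by
    rintro _ _ ⟨s, rfl⟩ ⟨t, rfl⟩
    exact ⟨s.mul t, rfl⟩
  add_mem' := by
    rintro _ _ ⟨s, rfl⟩ ⟨t, rfl⟩
    exact ⟨s.add t, rfl⟩
  algebraMap_mem' r := ⟨.scalar r, rfl⟩

section

variable {A : Type*} [CommRing A] [Algebra R A] {I : Ideal A} (hI : DividedPowers I) (f : V → A)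

instance : Small.{max u v} (closure (R := R) hI f) :=
  inferInstanceAs (Small.{max u v} (Set.range (Term.eval (R := R) hI f)))

theorem mem_closure (v : V) : f v ∈ closure (R := R) hI f := ⟨.gen v, rfl⟩

theorem dpow_mem_closure (n : ℕ) : ∀ x ∈ closure (R := R) hI f,
    hI.dpow n x ∈ closure (R := R) hI f := by
  rintro _ ⟨t, rfl⟩
  exact ⟨t.dpow n, rfl⟩

/-- The divided power structure induced on the closure. -/
def closureDividedPowers : DividedPowers (I.comap (closure (R := R) hI f).val) :=
  hI.restrictSubalgebra _ (dpow_mem_closure hI f)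

/-- Algebra homomorphisms compatible with divided powers are determined on the closure by their
values on the generators. -/
theorem closure_algHom_ext {S : Type*} [CommRing S] [Algebra R S] {J : Ideal S}
    (δ : DividedPowers J) {g h : closure (R := R) hI f →ₐ[R] S}
    (hgen : ∀ v, g ⟨f v, mem_closure hI f v⟩ = h ⟨f v, mem_closure hI f v⟩)
    (hg : ∀ x ∈ I.comap (closure (R := R) hI f).val, ∀ n : ℕ, 1 ≤ n →
      g ((closureDividedPowers hI f).dpow n x) = δ.dpow n (g x))
    (hh : ∀ x ∈ I.comap (closure (R := R) hI f).val, ∀ n : ℕ, 1 ≤ n →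
      h ((closureDividedPowers hI f).dpow n x) = δ.dpow n (h x)) : g = h := by
  have key (t : Term R V) : g ⟨t.eval hI f, t, rfl⟩ = h ⟨t.eval hI f, t, rfl⟩ := by
    induction t with
    | scalar r => exact (g.commutes r).trans (h.commutes r).symm
    | gen v => exact hgen v
    | add s t hs ht =>
      exact (map_add g _ _).trans ((congrArg₂ (· + ·) hs ht).trans (map_add h _ _).symm)
    | mul s t hs ht =>
      exact (map_mul g _ _).trans ((congrArg₂ (· * ·) hs ht).trans (map_mul h _ _).symm)
    | dpow n t ht =>
      change g ((closureDividedPowers hI f).dpow n ⟨t.eval hI f, t, rfl⟩) =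
        h ((closureDividedPowers hI f).dpow n ⟨t.eval hI f, t, rfl⟩)
      by_cases hx : (⟨t.eval hI f, t, rfl⟩ : closure (R := R) hI f) ∈
          I.comap (closure (R := R) hI f).val
      · obtain rfl | hn := Nat.eq_zero_or_pos n
        · simp only [DividedPowers.dpow_zero _ hx, map_one]
        · rw [hg _ hx n hn, hh _ hx n hn, ht]
      · simp only [DividedPowers.dpow_null _ hx, map_zero]
  ext ⟨_, t, rfl⟩
  exact key t

end

variable (R V) in
/-- An `R`-algebra with a divided power ideal and an `R`-linear map from `V` to that ideal. -/
structure Target [AddCommGroup V] [Module R V] where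
  S : Type s
  [commRing : CommRing S]
  [algebra : Algebra R S]
  J : Ideal S
  δ : DividedPowers J
  f : V →ₗ[R] S
  f_mem : ∀ v, f v ∈ J

attribute [instance] Target.commRing Target.algebra

end FreeDividedPowerAlgebra

open FreeDividedPowerAlgebra in
/-- free divided power algebras exist. -/
theorem nonempty_freeDividedPowerAlgebra (R : Type u) [CommRing R]
    (V : Type v) [AddCommGroup V] [Module R V] :
    Nonempty (FreeDividedPowerAlgebra.{u, v, s} R V) := by
  let δ := DividedPowers.pi fun i : Target.{u, v, s} R V ↦ i.δ
  let f : V →ₗ[R] ∀ i : Target.{u, v, s} R V, i.S := LinearMap.pi fun i ↦ i.f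
  let D := closure (R := R) δ f
  let e : Shrink.{max u v} D ≃ₐ[R] D := Shrink.algEquiv R D
  let γ := closureDividedPowers (R := R) δ f
  let ι : V →ₗ[R] D := f.codRestrict D.toSubmodule (mem_closure δ f)
  refine ⟨{
    Γ := Shrink.{max u v} D
    IΓ := _
    γ := DividedPowers.ofRingEquiv (e := e.symm.toRingEquiv) rfl γ
    ι := e.symm.toLinearMap ∘ₗ ι
    mem_ideal := fun v ↦ Ideal.mem_map_of_mem _ fun i ↦ i.f_mem v
    universal := ?_ }⟩
  intro S _ _ J δS fS hfS
  let i : Target.{u, v, s} R V := ⟨S, J, δS, fS, hfS⟩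
  let p : D →ₐ[R] S := (Pi.evalAlgHom R (fun i : Target.{u, v, s} R V ↦ i.S) i).comp D.val
  have he (v : V) : e (e.symm (ι v)) = ι v := e.apply_symm_apply _
  have mem_of_mem_map {x : Shrink.{max u v} D}
      (hx : x ∈ (Ideal.comap D.val (Ideal.pi fun i : Target.{u, v, s} R V ↦ i.J)).map
        e.symm.toRingEquiv) : e x ∈ Ideal.comap D.val (Ideal.pi fun i ↦ i.J) :=
    Ideal.symm_apply_mem_of_equiv_iff.2 hx
  have hp (x : D) (hx : x ∈ Ideal.comap D.val (Ideal.pi fun i ↦ i.J)) (n : ℕ) :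
      p (γ.dpow n x) = δS.dpow n (p x) :=
    DividedPowers.pi_dpow_apply (fun j : Target.{u, v, s} R V ↦ j.δ) n hx i
  refine ⟨p.comp e.toAlgHom, ⟨fun v ↦ ?_, fun x hx ↦ ?_, fun x hx n _ ↦ ?_⟩, ?_⟩
  · exact congrArg p (he v)
  · exact mem_of_mem_map hx i
  · exact (congrArg p (e.apply_symm_apply _)).trans (hp _ (mem_of_mem_map hx) n)
  · rintro g ⟨hg, -, hdp⟩
    have key : g.comp e.symm.toAlgHom = p := by
      refine closure_algHom_ext δ f δS (fun v ↦ hg v) (fun x hx n hn ↦ ?_)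
        (fun x hx n _ ↦ hp x hx n)
      have h := hdp (e.symm x) (Ideal.mem_map_of_mem _ hx) n hn
      have hx' : e (e.symm x) = x := e.apply_symm_apply x
      change g (e.symm (γ.dpow n (e (e.symm x)))) = _ at h
      rwa [hx'] at h
    ext x
    rw [← key]
    exact congrArg g (e.symm_apply_apply x).symm
end

section
/- Let R be a commutative ring and let A and B be nonunital commutative R-algebras equipped with divided power structures hA : DividedPowers I_A and hB : DividedPowers I_B on the augmentation ideals I_A ⊆ Unitization R A and I_B ⊆ Unitization R B. Let C = (Unitization R A) ⊗_R (Unitization R B) and let K ⊆ C be the kernel of the R-algebra map C → R induced by the two augmentations. Then there exists a unique divided power structure D : DividedPowers K such that D.dpow n (a ⊗ 1) = (hA.dpow n a) ⊗ 1 for all a ∈ I_A and D.dpow n (1 ⊗ b) = 1 ⊗ (hB.dpow n b) for all b ∈ I_B and all n ≥ 1. -/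
open scoped TensorProduct

open Finset in
/-- `IsPreDividedPowers I dp` says that `dp` satisfies on the ideal `I` the laws of a divided power
structure, except for the composition law `DividedPowers.dpow_comp`. -/
structure IsPreDividedPowers {S : Type*} [CommRing S] (I : Ideal S) (dp : ℕ → S → S) : Prop where
  zero {x : S} (hx : x ∈ I) : dp 0 x = 1
  mem {n : ℕ} {x : S} (hn : n ≠ 0) (hx : x ∈ I) : dp n x ∈ I
  add {n : ℕ} {x y : S} (hx : x ∈ I) (hy : y ∈ I) :
    dp n (x + y) = ∑ k ∈ antidiagonal n, dp k.1 x * dp k.2 y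
  mul {n : ℕ} {a x : S} (hx : x ∈ I) : dp n (a * x) = a ^ n * dp n x
  dpow_mul_dpow {m n : ℕ} {x : S} (hx : x ∈ I) :
    dp m x * dp n x = (m + n).choose m * dp (m + n) x

namespace DividedPowers

theorem isPreDividedPowers {S : Type*} [CommRing S] {I : Ideal S} (hI : DividedPowers I) :
    IsPreDividedPowers I hI.dpow :=
  ⟨hI.dpow_zero, hI.dpow_mem, hI.dpow_add, hI.dpow_mul, hI.mul_dpow⟩

end DividedPowers

namespace IsPreDividedPowers

open Finset

section Span

variable {S : Type*} [CommRing S] {I : Ideal S} {dp : ℕ → S → S} {x y : S}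

/-- The additive span of the products `dp i x * dp j y` with `i + j = d`. -/
def dpowSpan (dp : ℕ → S → S) (x y : S) (d : ℕ) : AddSubmonoid S :=
  AddSubmonoid.closure {z | ∃ i j, i + j = d ∧ dp i x * dp j y = z}

theorem dpow_mul_dpow_mem_dpowSpan (i j : ℕ) : dp i x * dp j y ∈ dpowSpan dp x y (i + j) :=
  AddSubmonoid.subset_closure ⟨i, j, rfl, rfl⟩

theorem exists_eq_sum_of_mem_dpowSpan {d : ℕ} {z : S} (hz : z ∈ dpowSpan dp x y d) :
    ∃ N : ℕ → ℕ, z = ∑ k ∈ antidiagonal d, N k.1 • (dp k.1 x * dp k.2 y) := by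
  induction hz using AddSubmonoid.closure_induction with
  | mem z hz =>
    obtain ⟨i, j, rfl, rfl⟩ := hz
    refine ⟨Pi.single i 1, ?_⟩
    rw [sum_eq_single (i, j)]
    · simp
    · rintro ⟨a, b⟩ hab hne
      have : a ≠ i := by
        rintro rfl
        simp_all
      simp [this]
    · simp
  | zero => exact ⟨0, by simp⟩
  | add u v _ _ hu hv =>
    obtain ⟨M, rfl⟩ := hu
    obtain ⟨N, rfl⟩ := hv
    exact ⟨M + N, by simp only [Pi.add_apply, add_smul, sum_add_distrib]⟩

variable (h : IsPreDividedPowers I dp) (hx : x ∈ I) (hy : y ∈ I)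
include h

theorem dpow_zero_eq_zero {n : ℕ} (hn : n ≠ 0) : dp n 0 = 0 := by
  simpa [zero_pow hn] using h.mul (n := n) (a := 0) I.zero_mem

include hx hy

theorem mul_mem_dpowSpan {d e : ℕ} {u v : S} (hu : u ∈ dpowSpan dp x y d)
    (hv : v ∈ dpowSpan dp x y e) : u * v ∈ dpowSpan dp x y (d + e) := by
  induction hu using AddSubmonoid.closure_induction with
  | mem u hu =>
    obtain ⟨i, j, rfl, rfl⟩ := hu
    induction hv using AddSubmonoid.closure_induction with
    | mem v hv =>
      obtain ⟨k, l, rfl, rfl⟩ := hv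
      have : dp i x * dp j y * (dp k x * dp l y) =
          ((i + k).choose i * (j + l).choose j) • (dp (i + k) x * dp (j + l) y) := by
        rw [mul_mul_mul_comm, h.dpow_mul_dpow hx, h.dpow_mul_dpow hy, nsmul_eq_mul]
        push_cast
        ring
      rw [this, add_add_add_comm]
      exact nsmul_mem (dpow_mul_dpow_mem_dpowSpan _ _) _
    | zero => simp
    | add u v _ _ hu hv => rw [mul_add]; exact add_mem hu hv
  | zero => simp
  | add u v _ _ hu hv => rw [add_mul]; exact add_mem hu hv

theorem one_mem_dpowSpan : 1 ∈ dpowSpan dp x y 0 := by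
  simpa [h.zero hx, h.zero hy] using dpow_mul_dpow_mem_dpowSpan (dp := dp) (x := x) (y := y) 0 0

theorem pow_mem_dpowSpan {d : ℕ} {u : S} (hu : u ∈ dpowSpan dp x y d) (m : ℕ) :
    u ^ m ∈ dpowSpan dp x y (m * d) := by
  induction m with
  | zero => simpa using h.one_mem_dpowSpan hx hy
  | succ m ih => rw [pow_succ, add_one_mul]; exact h.mul_mem_dpowSpan hx hy ih hu

theorem dpow_sum_mem_dpowSpan {ι : Type*} {s : Finset ι} {u : ι → S} {d : ℕ}
    (hu : ∀ i ∈ s, u i ∈ I) (hud : ∀ i ∈ s, ∀ m, dp m (u i) ∈ dpowSpan dp x y (m * d)) (m : ℕ) :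
    dp m (∑ i ∈ s, u i) ∈ dpowSpan dp x y (m * d) := by
  classical
  induction s using Finset.induction generalizing m with
  | empty =>
    rw [sum_empty]
    rcases eq_or_ne m 0 with rfl | hm
    · rw [h.zero I.zero_mem, zero_mul]
      exact h.one_mem_dpowSpan hx hy
    · rw [h.dpow_zero_eq_zero hm]
      exact zero_mem _
  | insert a s ha ih =>
    simp only [mem_insert, forall_eq_or_imp] at hu hud
    rw [sum_insert ha, h.add hu.1 (I.sum_mem hu.2)]
    refine sum_mem fun k hk ↦ ?_
    rw [← mem_antidiagonal.mp hk, add_mul]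
    exact h.mul_mem_dpowSpan hx hy (hud.1 _) (ih hu.2 hud.2 _)

theorem dpow_dpow_add_mem_dpowSpan
    (hx' : ∀ m n, n ≠ 0 → dp m (dp n x) = m.uniformBell n * dp (m * n) x)
    (hy' : ∀ m n, n ≠ 0 → dp m (dp n y) = m.uniformBell n * dp (m * n) y)
    (m : ℕ) {n : ℕ} (hn : n ≠ 0) : dp m (dp n (x + y)) ∈ dpowSpan dp x y (m * n) := by
  rw [h.add hx hy]
  have left (k : ℕ) : dp k x ∈ dpowSpan dp x y k := by
    simpa [h.zero hy] using dpow_mul_dpow_mem_dpowSpan (dp := dp) (x := x) (y := y) k 0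
  have right (k : ℕ) : dp k y ∈ dpowSpan dp x y k := by
    simpa [h.zero hx] using dpow_mul_dpow_mem_dpowSpan (dp := dp) (x := x) (y := y) 0 k
  apply h.dpow_sum_mem_dpowSpan hx hy
  · rintro ⟨i, j⟩ hij
    rcases eq_or_ne i 0 with rfl | hi
    · have : j ≠ 0 := by simp_all
      exact I.mul_mem_left _ (h.mem this hy)
    · exact I.mul_mem_right _ (h.mem hi hx)
  · rintro ⟨i, j⟩ hij m
    obtain rfl : i + j = n := mem_antidiagonal.mp hij
    rcases eq_or_ne i 0 with rfl | hi
    · have : j ≠ 0 := by simp_all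
      simp only [h.zero hx, one_mul, hy' m j this, zero_add, ← nsmul_eq_mul]
      exact nsmul_mem (right _) _
    · dsimp only
      rw [mul_comm (dp i x), h.mul (h.mem hi hx), hx' m i hi, mul_add, add_comm (m * i)]
      refine h.mul_mem_dpowSpan hx hy (h.pow_mem_dpowSpan hx hy (right j) m) ?_
      rw [← nsmul_eq_mul]
      exact nsmul_mem (left _) _

end Span

theorem prod {S T : Type*} [CommRing S] [CommRing T] {I : Ideal S} {J : Ideal T}
    {dp : ℕ → S → S} {dp' : ℕ → T → T} (h : IsPreDividedPowers I dp)
    (h' : IsPreDividedPowers J dp') :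
    IsPreDividedPowers (I.prod J) fun n z ↦ (dp n z.1, dp' n z.2) where
  zero hx := Prod.ext (h.zero hx.1) (h'.zero hx.2)
  mem hn hx := ⟨h.mem hn hx.1, h'.mem hn hx.2⟩
  add hx hy := by
    ext
    · simpa [Prod.fst_sum] using h.add hx.1 hy.1
    · simpa [Prod.snd_sum] using h'.add hx.2 hy.2
  mul hx := Prod.ext (h.mul hx.1) (h'.mul hx.2)
  dpow_mul_dpow hx := Prod.ext (h.dpow_mul_dpow hx.1) (h'.dpow_mul_dpow hx.2)

open Polynomial in
/-- The composition law for divided powers is stable under addition. -/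
theorem dpow_comp_add {S : Type*} [CommRing S] {I : Ideal S} {dp : ℕ → S → S}
    (h : IsPreDividedPowers I dp) {x y : S} (hx : x ∈ I) (hy : y ∈ I)
    (hx' : ∀ m n, n ≠ 0 → dp m (dp n x) = m.uniformBell n * dp (m * n) x)
    (hy' : ∀ m n, n ≠ 0 → dp m (dp n y) = m.uniformBell n * dp (m * n) y)
    (m n : ℕ) (hn : n ≠ 0) :
    dp m (dp n (x + y)) = m.uniformBell n * dp (m * n) (x + y) := by
  classical
  let Q : DividedPowers (⊤ : Ideal ℚ[X]) := DividedPowers.RatAlgebra.dividedPowers ⊤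
  have hQ (k : ℕ) (p : ℚ[X]) : Q.dpow k p = C ((k.factorial : ℚ)⁻¹) * p ^ k := by
    have := Q.factorial_mul_dpow_eq_pow (n := k) (Submodule.mem_top : p ∈ ⊤)
    rw [← this, ← mul_assoc, ← C_eq_natCast, ← C_mul, inv_mul_cancel₀, C_1, one_mul]
    exact_mod_cast k.factorial_ne_zero
  have hprod := h.prod Q.isPreDividedPowers
  obtain ⟨N, hN⟩ := exists_eq_sum_of_mem_dpowSpan <|
    hprod.dpow_dpow_add_mem_dpowSpan (x := (x, X)) (y := (y, 1))
      ⟨hx, Submodule.mem_top⟩ ⟨hy, Submodule.mem_top⟩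
      (fun m n hn ↦ Prod.ext (hx' m n hn) (Q.dpow_comp hn Submodule.mem_top))
      (fun m n hn ↦ Prod.ext (hy' m n hn) (Q.dpow_comp hn Submodule.mem_top)) m hn
  simp only [Prod.ext_iff, Prod.fst_sum, Prod.snd_sum, Prod.smul_fst, Prod.smul_snd, Prod.fst_add,
    Prod.snd_add, Prod.mk_mul_mk] at hN
  have key : ∀ k ∈ antidiagonal (m * n), N k.1 = m.uniformBell n := by
    rintro ⟨i, j⟩ hij
    have hcoeff := congr_arg (coeff · i) hN.2
    have aux (M : ℕ → ℕ) :
        (∑ k ∈ antidiagonal (m * n), M k.1 • (Q.dpow k.1 X * Q.dpow k.2 1)).coeff i =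
          M i * ((i.factorial : ℚ)⁻¹ * (j.factorial : ℚ)⁻¹) := by
      rw [finsetSum_coeff, sum_eq_single (i, j)]
      · rw [hQ, hQ, one_pow, mul_one, mul_right_comm, ← C_mul, coeff_smul, coeff_C_mul_X_pow,
          if_pos rfl, nsmul_eq_mul]
      · rintro ⟨a, b⟩ hab hne
        have : i ≠ a := by
          rintro rfl
          simp_all
          omega
        simp [hQ, coeff_X_pow, this, mul_assoc]
      · exact fun hij' ↦ absurd hij hij'
    have hij0 : (i.factorial : ℚ)⁻¹ * (j.factorial : ℚ)⁻¹ ≠ 0 := by positivity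
    rw [Q.dpow_comp hn Submodule.mem_top, Q.dpow_add Submodule.mem_top Submodule.mem_top, mul_sum]
      at hcoeff
    simp only [← nsmul_eq_mul] at hcoeff
    rw [aux, aux fun _ ↦ m.uniformBell n] at hcoeff
    exact_mod_cast (mul_right_cancel₀ hij0 hcoeff).symm
  rw [hN.1, h.add hx hy, mul_sum]
  exact sum_congr rfl fun k hk ↦ by rw [key k hk, nsmul_eq_mul]

end IsPreDividedPowers

namespace PowerSeries

open Finset

variable {S : Type*} [CommRing S]

open scoped Polynomial in
theorem coeff_map_mul_rescale_map (F : S⟦X⟧) (n j : ℕ) (hj : j ≤ n) :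
    (coeff n (F.map Polynomial.C * rescale Polynomial.X (F.map Polynomial.C))).coeff j =
      coeff (n - j) F * coeff j F := by
  rw [coeff_mul, Polynomial.finsetSum_coeff, sum_eq_single (n - j, j)]
  · simp [Polynomial.coeff_X_pow]
  · rintro ⟨a, b⟩ hab hne
    have : j ≠ b := by
      rintro rfl
      simp_all
      omega
    simp [Polynomial.coeff_X_pow, this]
  · intro h
    simp [hj] at h

open scoped Polynomial in
/-- The coefficients of a power series multiply like divided powers if and only if the series
satisfies the functional equation `F(X) F(YX) = F((1 + Y)X)` of the exponential. -/
theorem map_mul_rescale_eq_iff (F : S⟦X⟧) :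
    F.map Polynomial.C * rescale (Polynomial.X : S[X]) (F.map Polynomial.C) =
        rescale (1 + Polynomial.X) (F.map Polynomial.C) ↔
      ∀ m n, coeff m F * coeff n F = (m + n).choose m * coeff (m + n) F := by
  have hr (n j : ℕ) :
      (coeff n (rescale (1 + Polynomial.X : S[X]) (F.map Polynomial.C))).coeff j =
        n.choose j * coeff n F := by
    rw [coeff_rescale, coeff_map, Polynomial.coeff_mul_C, Polynomial.coeff_one_add_X_pow]
  constructor
  · intro h m n
    have := congr_arg (fun G : S[X]⟦X⟧ ↦ (coeff (m + n) G).coeff n) h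
    simp only [hr] at this
    rwa [coeff_map_mul_rescale_map _ _ _ (by omega), Nat.add_sub_cancel,
      ← Nat.choose_symm_add] at this
  · intro h
    ext n j
    rw [hr]
    rcases le_or_gt j n with hj | hj
    · rw [coeff_map_mul_rescale_map _ _ _ hj, h, Nat.sub_add_cancel hj, Nat.choose_symm hj]
    · rw [Nat.choose_eq_zero_of_lt hj, Nat.cast_zero, zero_mul, coeff_mul,
        Polynomial.finsetSum_coeff]
      refine sum_eq_zero fun k hk ↦ ?_
      have : j ≠ k.2 := by
        have := mem_antidiagonal.mp hk
        omega
      simp [Polynomial.coeff_X_pow, this]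

theorem coeff_mul_coeff_mul {F G : S⟦X⟧}
    (hF : ∀ m n, coeff m F * coeff n F = (m + n).choose m * coeff (m + n) F)
    (hG : ∀ m n, coeff m G * coeff n G = (m + n).choose m * coeff (m + n) G) (m n : ℕ) :
    coeff m (F * G) * coeff n (F * G) = (m + n).choose m * coeff (m + n) (F * G) := by
  revert m n
  rw [← map_mul_rescale_eq_iff] at hF hG ⊢
  rw [map_mul, map_mul, map_mul, mul_mul_mul_comm, hF, hG]

theorem rescale_add_of_coeff_mul_coeff {F : S⟦X⟧}
    (hF : ∀ m n, coeff m F * coeff n F = (m + n).choose m * coeff (m + n) F) (a b : S) :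
    rescale (a + b) F = rescale a F * rescale b F := by
  ext n
  rw [coeff_mul, coeff_rescale, (Commute.all a b).add_pow', sum_mul]
  refine sum_congr rfl fun k hk ↦ ?_
  obtain rfl := mem_antidiagonal.mp hk
  rw [coeff_rescale, coeff_rescale, mul_mul_mul_comm, hF, nsmul_eq_mul]
  ring

end PowerSeries

namespace DividedPowers

open Finset PowerSeries

section Augmented

variable {R S T : Type*} [CommRing R] [CommRing S] [CommRing T] [Algebra R S] [Algebra R T]
  {f : S →ₐ[R] R} {g : T →ₐ[R] R}

variable (f) in
/-- The projection of an augmented algebra onto its augmentation ideal. -/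
def augProj : S →ₗ[R] S := LinearMap.id - (Algebra.linearMap R S).comp f.toLinearMap

theorem augProj_apply (s : S) : augProj f s = s - algebraMap R S (f s) := rfl

theorem augProj_mem (s : S) : augProj f s ∈ RingHom.ker f := by
  simp [augProj_apply, RingHom.mem_ker]

theorem augProj_of_mem {s : S} (hs : s ∈ RingHom.ker f) : augProj f s = s := by
  rw [augProj_apply, (RingHom.mem_ker).mp hs, map_zero, sub_zero]

/-- The algebra map `S ⊗ T → T` induced by an augmentation of `S`. -/
noncomputable def augRight (T : Type*) [CommRing T] [Algebra R T] (f : S →ₐ[R] R) :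
    S ⊗[R] T →ₐ[R] T :=
  Algebra.TensorProduct.productMap ((Algebra.ofId R T).comp f) (AlgHom.id R T)

theorem augRight_tmul (s : S) (t : T) : augRight T f (s ⊗ₜ t) = algebraMap R T (f s) * t := rfl

theorem map_augRight (z : S ⊗[R] T) :
    g (augRight T f z) = Algebra.TensorProduct.productMap f g z := by
  induction z with
  | zero => simp
  | tmul s t => simp [augRight_tmul]
  | add u v hu hv => simp only [map_add, hu, hv]

theorem map_augProj_add_augRight (z : S ⊗[R] T) :
    TensorProduct.map (augProj f) LinearMap.id z + 1 ⊗ₜ augRight T f z = z := by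
  induction z with
  | zero => simp
  | tmul s t =>
    rw [TensorProduct.map_tmul, augRight_tmul, LinearMap.id_apply, ← Algebra.smul_def,
      ← TensorProduct.smul_tmul, ← TensorProduct.add_tmul, augProj_apply,
      ← Algebra.algebraMap_eq_smul_one, sub_add_cancel]
  | add u v hu hv =>
    rw [map_add, map_add, TensorProduct.tmul_add, add_add_add_comm, hu, hv]

theorem tmul_mem_of_left {s : S} (hs : s ∈ RingHom.ker f) (t : T) :
    s ⊗ₜ t ∈ RingHom.ker (Algebra.TensorProduct.productMap f g) := by
  rw [RingHom.mem_ker, Algebra.TensorProduct.productMap_apply_tmul,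
    (RingHom.mem_ker).mp hs, zero_mul]

theorem tmul_mem_of_right (s : S) {t : T} (ht : t ∈ RingHom.ker g) :
    s ⊗ₜ t ∈ RingHom.ker (Algebra.TensorProduct.productMap f g) := by
  rw [RingHom.mem_ker, Algebra.TensorProduct.productMap_apply_tmul,
    (RingHom.mem_ker).mp ht, mul_zero]

theorem augRight_mem {z : S ⊗[R] T}
    (hz : z ∈ RingHom.ker (Algebra.TensorProduct.productMap f g)) :
    augRight T f z ∈ RingHom.ker g := by
  rwa [RingHom.mem_ker, map_augRight, ← RingHom.mem_ker]

/-- The kernel of the augmentation of `S ⊗ T` is additively generated by the tensors one of whose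
factors lies in an augmentation ideal. -/
@[elab_as_elim]
theorem ker_productMap_induction
    {p : (z : S ⊗[R] T) → z ∈ RingHom.ker (Algebra.TensorProduct.productMap f g) → Prop}
    (zero : p 0 (zero_mem _))
    (left : ∀ s (hs : s ∈ RingHom.ker f) t, p (s ⊗ₜ t) (tmul_mem_of_left hs t))
    (right : ∀ s t (ht : t ∈ RingHom.ker g), p (s ⊗ₜ t) (tmul_mem_of_right s ht))
    (add : ∀ u v hu hv, p u hu → p v hv → p (u + v) (add_mem hu hv))
    {z : S ⊗[R] T} (hz : z ∈ RingHom.ker (Algebra.TensorProduct.productMap f g)) : p z hz := by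
  have key (w : S ⊗[R] T) : ∃ hw, p (TensorProduct.map (augProj f) LinearMap.id w) hw := by
    induction w with
    | zero => exact ⟨by simp, by simpa using zero⟩
    | tmul s t => exact ⟨_, left _ (augProj_mem s) t⟩
    | add u v hu hv =>
      obtain ⟨hu, hu'⟩ := hu
      obtain ⟨hv, hv'⟩ := hv
      simp only [map_add]
      exact ⟨add_mem hu hv, add _ _ hu hv hu' hv'⟩
  obtain ⟨hw, hw'⟩ := key z
  have := add _ _ hw _ hw' (right 1 _ (augRight_mem hz))
  simpa only [map_augProj_add_augRight] using this

/-- The exponential series of `s ⊗ t`, for `s` in the augmentation ideal. -/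
noncomputable def tmulExp (hI : DividedPowers (RingHom.ker f)) (s : S) (t : T) : (S ⊗[R] T)⟦X⟧ :=
  PowerSeries.mk fun n ↦ hI.dpow n s ⊗ₜ[R] (t ^ n)

section tmulExp

variable (hI : DividedPowers (RingHom.ker f)) {s u : S} (hs : s ∈ RingHom.ker f)

theorem tmulExp_zero_left (t : T) : tmulExp hI 0 t = 1 := by
  ext n
  rw [tmulExp, coeff_mk, coeff_one]
  split_ifs with hn
  · rw [hn, hI.dpow_zero (zero_mem _), pow_zero, Algebra.TensorProduct.one_def]
  · rw [hI.dpow_eval_zero hn, TensorProduct.zero_tmul]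

include hs

theorem tmulExp_zero_right : tmulExp hI s (0 : T) = 1 := by
  ext n
  rw [tmulExp, coeff_mk, coeff_one]
  split_ifs with hn
  · rw [hn, hI.dpow_zero hs, pow_zero, Algebra.TensorProduct.one_def]
  · rw [zero_pow hn, TensorProduct.tmul_zero]

theorem tmulExp_add_left (hu : u ∈ RingHom.ker f) (t : T) :
    tmulExp hI (s + u) t = tmulExp hI s t * tmulExp hI u t := by
  ext n
  rw [tmulExp, coeff_mk, coeff_mul, hI.dpow_add hs hu, TensorProduct.sum_tmul]
  refine sum_congr rfl fun k hk ↦ ?_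
  obtain rfl := mem_antidiagonal.mp hk
  rw [tmulExp, tmulExp, coeff_mk, coeff_mk, Algebra.TensorProduct.tmul_mul_tmul, pow_add]

theorem tmulExp_add_right (t v : T) :
    tmulExp hI s (t + v) = tmulExp hI s t * tmulExp hI s v := by
  ext n
  rw [tmulExp, coeff_mk, coeff_mul, (Commute.all t v).add_pow', TensorProduct.tmul_sum]
  refine sum_congr rfl fun k hk ↦ ?_
  obtain rfl := mem_antidiagonal.mp hk
  rw [tmulExp, tmulExp, coeff_mk, coeff_mk, Algebra.TensorProduct.tmul_mul_tmul,
    hI.mul_dpow hs, ← nsmul_eq_mul, TensorProduct.smul_tmul]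

theorem tmulExp_smul (r : R) (t : T) : tmulExp hI (r • s) t = tmulExp hI s (r • t) := by
  ext n
  rw [tmulExp, tmulExp, coeff_mk, coeff_mk, Algebra.smul_def, hI.dpow_mul hs, ← map_pow,
    ← Algebra.smul_def, smul_pow, TensorProduct.smul_tmul]

end tmulExp

variable (T) in
/-- The additive map sending `s ⊗ t` to the exponential series of `s' ⊗ t`, where `s'` is the
component of `s` in the augmentation ideal. -/
noncomputable def tensorExpLeft (hI : DividedPowers (RingHom.ker f)) :
    S ⊗[R] T →+ Additive (S ⊗[R] T)⟦X⟧ :=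
  TensorProduct.liftAddHom
    { toFun := fun s ↦
        { toFun := fun t ↦ Additive.ofMul (tmulExp hI (augProj f s) t)
          map_zero' := tmulExp_zero_right hI (augProj_mem s)
          map_add' := tmulExp_add_right hI (augProj_mem s) }
      map_zero' := by
        refine AddMonoidHom.ext fun t ↦ ?_
        exact congr_arg Additive.ofMul ((congr_arg (tmulExp hI · t) (map_zero (augProj f))).trans
          (tmulExp_zero_left hI t))
      map_add' := fun s u ↦ by
        refine AddMonoidHom.ext fun t ↦ ?_
        exact congr_arg Additive.ofMul ((congr_arg (tmulExp hI · t) (map_add (augProj f) s u)).trans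
          (tmulExp_add_left hI (augProj_mem s) (augProj_mem u) t)) }
    (fun r s t ↦ congr_arg Additive.ofMul <|
      (congr_arg (tmulExp hI · t) (map_smul (augProj f) r s)).trans
        (tmulExp_smul hI (augProj_mem s) r t))

theorem tensorExpLeft_tmul (hI : DividedPowers (RingHom.ker f)) (s : S) (t : T) :
    (tensorExpLeft T hI (s ⊗ₜ t)).toMul = tmulExp hI (augProj f s) t := rfl

variable (hI : DividedPowers (RingHom.ker f)) (hJ : DividedPowers (RingHom.ker g))

/-- The exponential series `∑ (dpow n z) X ^ n` of the divided power structure on the kernel of the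
augmentation of `S ⊗ T`. -/
noncomputable def tensorExp (z : S ⊗[R] T) : (S ⊗[R] T)⟦X⟧ :=
  (tensorExpLeft T hI z).toMul *
    (hJ.exp (augRight T f z)).map (Algebra.TensorProduct.includeRight : T →ₐ[R] S ⊗[R] T).toRingHom

theorem exp_zero : hJ.exp (0 : T) = 1 := by
  ext n
  rw [exp, coeff_mk, coeff_one]
  split_ifs with hn
  · rw [hn, hJ.dpow_zero (zero_mem _)]
  · exact hJ.dpow_eval_zero hn

theorem tensorExp_tmul_of_mem_left {s : S} (hs : s ∈ RingHom.ker f) (t : T) :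
    tensorExp hI hJ (s ⊗ₜ t) = PowerSeries.mk fun n ↦ hI.dpow n s ⊗ₜ[R] (t ^ n) := by
  rw [tensorExp, augRight_tmul, (RingHom.mem_ker).mp hs, map_zero, zero_mul, exp_zero, map_one,
    mul_one, tensorExpLeft_tmul, augProj_of_mem hs, tmulExp]

theorem tensorExp_tmul_of_mem_right (s : S) {t : T} (ht : t ∈ RingHom.ker g) :
    tensorExp hI hJ (s ⊗ₜ t) = PowerSeries.mk fun n ↦ (s ^ n) ⊗ₜ[R] hJ.dpow n t := by
  have hs : s = augProj f s + algebraMap R S (f s) := by rw [augProj_apply, sub_add_cancel]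
  ext n
  rw [tensorExp, augRight_tmul, tensorExpLeft_tmul, tmulExp, coeff_mul, coeff_mk]
  conv_rhs => rw [hs, (Commute.all _ _).add_pow', TensorProduct.sum_tmul]
  refine sum_congr rfl fun k hk ↦ ?_
  obtain rfl := mem_antidiagonal.mp hk
  have h1 : hI.dpow k.1 (augProj f s) ⊗ₜ[R] (t ^ k.1) =
      (augProj f s ^ k.1) ⊗ₜ[R] hJ.dpow k.1 t := by
    rw [← hI.factorial_mul_dpow_eq_pow (augProj_mem s), ← hJ.factorial_mul_dpow_eq_pow ht,
      ← nsmul_eq_mul, ← nsmul_eq_mul, TensorProduct.smul_tmul]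
  have h2 : (1 : S) ⊗ₜ[R] (algebraMap R T (f s) ^ k.2 * hJ.dpow k.2 t) =
      (algebraMap R S (f s) ^ k.2) ⊗ₜ[R] hJ.dpow k.2 t := by
    rw [← map_pow, ← Algebra.smul_def, ← TensorProduct.smul_tmul,
      ← Algebra.algebraMap_eq_smul_one, map_pow]
  rw [coeff_mk, coeff_map, exp, coeff_mk, hJ.dpow_mul ht, h1, AlgHom.toRingHom_eq_coe,
    RingHom.coe_coe, Algebra.TensorProduct.includeRight_apply, h2,
    Algebra.TensorProduct.tmul_mul_tmul, hJ.mul_dpow ht, ← nsmul_eq_mul, TensorProduct.smul_tmul]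

theorem tensorExp_zero : tensorExp hI hJ 0 = 1 := by
  rw [tensorExp, map_zero (augRight T f), map_zero (tensorExpLeft T hI), exp_zero, map_one, mul_one,
    toMul_zero]

theorem tensorExp_add {z w : S ⊗[R] T}
    (hz : z ∈ RingHom.ker (Algebra.TensorProduct.productMap f g))
    (hw : w ∈ RingHom.ker (Algebra.TensorProduct.productMap f g)) :
    tensorExp hI hJ (z + w) = tensorExp hI hJ z * tensorExp hI hJ w := by
  simp only [tensorExp]
  rw [map_add (augRight T f), map_add (tensorExpLeft T hI), toMul_add,
    hJ.exp_add (augRight_mem hz) (augRight_mem hw), map_mul,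
    mul_mul_mul_comm]

theorem tensorExp_coeff_mul_coeff {z : S ⊗[R] T}
    (hz : z ∈ RingHom.ker (Algebra.TensorProduct.productMap f g)) :
    ∀ m n, coeff m (tensorExp hI hJ z) * coeff n (tensorExp hI hJ z) =
      (m + n).choose m * coeff (m + n) (tensorExp hI hJ z) := by
  induction hz using ker_productMap_induction with
  | zero =>
    intro m n
    rw [tensorExp_zero, coeff_one, coeff_one, coeff_one]
    rcases eq_or_ne m 0 with rfl | hm <;> simp [*]
  | left s hs t =>
    intro m n
    rw [tensorExp_tmul_of_mem_left hI hJ hs, coeff_mk, coeff_mk, coeff_mk,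
      Algebra.TensorProduct.tmul_mul_tmul, hI.mul_dpow hs, ← nsmul_eq_mul, ← nsmul_eq_mul,
      TensorProduct.smul_tmul', pow_add]
  | right s t ht =>
    intro m n
    rw [tensorExp_tmul_of_mem_right hI hJ s ht, coeff_mk, coeff_mk, coeff_mk,
      Algebra.TensorProduct.tmul_mul_tmul, hJ.mul_dpow ht, ← nsmul_eq_mul, ← nsmul_eq_mul,
      TensorProduct.tmul_smul, pow_add]
  | add u v hu hv hu' hv' =>
    rw [tensorExp_add hI hJ hu hv]
    exact coeff_mul_coeff_mul hu' hv'

theorem constantCoeff_tensorExp {z : S ⊗[R] T}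
    (hz : z ∈ RingHom.ker (Algebra.TensorProduct.productMap f g)) :
    constantCoeff (tensorExp hI hJ z) = 1 := by
  induction hz using ker_productMap_induction with
  | zero => rw [tensorExp_zero, map_one]
  | left s hs t =>
    rw [tensorExp_tmul_of_mem_left hI hJ hs, ← coeff_zero_eq_constantCoeff_apply, coeff_mk,
      hI.dpow_zero hs, pow_zero, Algebra.TensorProduct.one_def]
  | right s t ht =>
    rw [tensorExp_tmul_of_mem_right hI hJ s ht, ← coeff_zero_eq_constantCoeff_apply, coeff_mk,
      hJ.dpow_zero ht, pow_zero, Algebra.TensorProduct.one_def]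
  | add u v hu hv hu' hv' => rw [tensorExp_add hI hJ hu hv, map_mul, hu', hv', mul_one]

theorem tensorExp_mul (c : S ⊗[R] T) {z : S ⊗[R] T}
    (hz : z ∈ RingHom.ker (Algebra.TensorProduct.productMap f g)) :
    tensorExp hI hJ (c * z) = rescale c (tensorExp hI hJ z) := by
  induction hz using ker_productMap_induction with
  | zero => rw [mul_zero, tensorExp_zero, map_one]
  | left s hs t =>
    have hst := tmul_mem_of_left (g := g) hs t
    induction c with
    | zero =>
      rw [zero_mul, tensorExp_zero, rescale_zero_apply, constantCoeff_tensorExp hI hJ hst, map_one]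
    | tmul a b =>
      rw [Algebra.TensorProduct.tmul_mul_tmul, tensorExp_tmul_of_mem_left hI hJ hs,
        tensorExp_tmul_of_mem_left hI hJ (Ideal.mul_mem_left _ a hs), rescale_mk]
      ext n
      rw [coeff_mk, coeff_mk, hI.dpow_mul hs, mul_pow, Algebra.TensorProduct.tmul_pow,
        Algebra.TensorProduct.tmul_mul_tmul]
    | add a b ha hb =>
      rw [add_mul, tensorExp_add hI hJ (Ideal.mul_mem_left _ a hst) (Ideal.mul_mem_left _ b hst),
        ha, hb, rescale_add_of_coeff_mul_coeff (tensorExp_coeff_mul_coeff hI hJ hst)]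
  | right s t ht =>
    have hst := tmul_mem_of_right (f := f) s ht
    induction c with
    | zero =>
      rw [zero_mul, tensorExp_zero, rescale_zero_apply, constantCoeff_tensorExp hI hJ hst, map_one]
    | tmul a b =>
      rw [Algebra.TensorProduct.tmul_mul_tmul, tensorExp_tmul_of_mem_right hI hJ s ht,
        tensorExp_tmul_of_mem_right hI hJ _ (Ideal.mul_mem_left _ b ht), rescale_mk]
      ext n
      rw [coeff_mk, coeff_mk, hJ.dpow_mul ht, mul_pow, Algebra.TensorProduct.tmul_pow,
        Algebra.TensorProduct.tmul_mul_tmul]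
    | add a b ha hb =>
      rw [add_mul, tensorExp_add hI hJ (Ideal.mul_mem_left _ a hst) (Ideal.mul_mem_left _ b hst),
        ha, hb, rescale_add_of_coeff_mul_coeff (tensorExp_coeff_mul_coeff hI hJ hst)]
  | add u v hu hv hu' hv' =>
    rw [mul_add, tensorExp_add hI hJ (Ideal.mul_mem_left _ c hu) (Ideal.mul_mem_left _ c hv),
      hu', hv', tensorExp_add hI hJ hu hv, map_mul]

theorem coeff_one_tensorExp {z : S ⊗[R] T}
    (hz : z ∈ RingHom.ker (Algebra.TensorProduct.productMap f g)) :
    coeff 1 (tensorExp hI hJ z) = z := by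
  induction hz using ker_productMap_induction with
  | zero => simp [tensorExp_zero, coeff_one]
  | left s hs t =>
    rw [tensorExp_tmul_of_mem_left hI hJ hs, coeff_mk, hI.dpow_one hs, pow_one]
  | right s t ht =>
    rw [tensorExp_tmul_of_mem_right hI hJ s ht, coeff_mk, hJ.dpow_one ht, pow_one]
  | add u v hu hv hu' hv' =>
    rw [tensorExp_add hI hJ hu hv, coeff_one_mul, hu', hv', constantCoeff_tensorExp hI hJ hu,
      constantCoeff_tensorExp hI hJ hv, mul_one, mul_one]

theorem coeff_tensorExp_mem {z : S ⊗[R] T}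
    (hz : z ∈ RingHom.ker (Algebra.TensorProduct.productMap f g)) :
    ∀ n ≠ 0, coeff n (tensorExp hI hJ z) ∈
      RingHom.ker (Algebra.TensorProduct.productMap f g) := by
  induction hz using ker_productMap_induction with
  | zero =>
    intro n hn
    rw [tensorExp_zero, coeff_one, if_neg hn]
    exact zero_mem _
  | left s hs t =>
    intro n hn
    rw [tensorExp_tmul_of_mem_left hI hJ hs, coeff_mk, RingHom.mem_ker,
      Algebra.TensorProduct.productMap_apply_tmul, (RingHom.mem_ker).mp (hI.dpow_mem hn hs),
      zero_mul]
  | right s t ht =>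
    intro n hn
    rw [tensorExp_tmul_of_mem_right hI hJ s ht, coeff_mk, RingHom.mem_ker,
      Algebra.TensorProduct.productMap_apply_tmul, (RingHom.mem_ker).mp (hJ.dpow_mem hn ht),
      mul_zero]
  | add u v hu hv hu' hv' =>
    intro n hn
    rw [tensorExp_add hI hJ hu hv, coeff_mul]
    refine sum_mem fun k hk ↦ ?_
    rcases eq_or_ne k.1 0 with hk1 | hk1
    · refine Ideal.mul_mem_left _ _ (hv' _ ?_)
      have := mem_antidiagonal.mp hk
      omega
    · exact Ideal.mul_mem_right _ _ (hu' _ hk1)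

theorem isPreDividedPowers_tensorExp :
    IsPreDividedPowers (RingHom.ker (Algebra.TensorProduct.productMap f g))
      fun n z ↦ coeff n (tensorExp hI hJ z) where
  zero hz := by
    rw [coeff_zero_eq_constantCoeff_apply, constantCoeff_tensorExp hI hJ hz]
  mem hn hz := coeff_tensorExp_mem hI hJ hz _ hn
  add hz hw := by rw [tensorExp_add hI hJ hz hw, coeff_mul]
  mul hz := by rw [tensorExp_mul hI hJ _ hz, coeff_rescale]
  dpow_mul_dpow hz := tensorExp_coeff_mul_coeff hI hJ hz _ _

theorem tensorExp_comp {z : S ⊗[R] T}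
    (hz : z ∈ RingHom.ker (Algebra.TensorProduct.productMap f g)) :
    ∀ m n, n ≠ 0 → coeff m (tensorExp hI hJ (coeff n (tensorExp hI hJ z))) =
      m.uniformBell n * coeff (m * n) (tensorExp hI hJ z) := by
  induction hz using ker_productMap_induction with
  | zero =>
    intro m n hn
    rw [tensorExp_zero, coeff_one, if_neg hn, tensorExp_zero, coeff_one, coeff_one]
    rcases eq_or_ne m 0 with rfl | hm <;> simp [*, Nat.uniformBell_zero_left]
  | left s hs t =>
    intro m n hn
    rw [tensorExp_tmul_of_mem_left hI hJ hs, coeff_mk,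
      tensorExp_tmul_of_mem_left hI hJ (hI.dpow_mem hn hs), coeff_mk, coeff_mk,
      hI.dpow_comp hn hs, ← pow_mul, mul_comm n, ← nsmul_eq_mul, ← nsmul_eq_mul,
      TensorProduct.smul_tmul']
  | right s t ht =>
    intro m n hn
    rw [tensorExp_tmul_of_mem_right hI hJ s ht, coeff_mk,
      tensorExp_tmul_of_mem_right hI hJ _ (hJ.dpow_mem hn ht), coeff_mk, coeff_mk,
      hJ.dpow_comp hn ht, ← pow_mul, mul_comm n, ← nsmul_eq_mul, ← nsmul_eq_mul,
      TensorProduct.tmul_smul]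
  | add u v hu hv hu' hv' =>
    exact (isPreDividedPowers_tensorExp hI hJ).dpow_comp_add hu hv hu' hv'

open Classical in
/-- The divided power structure on the kernel of the augmentation of `S ⊗ T` induced by divided
power structures on the augmentation ideals of `S` and `T`. -/
noncomputable def tensor :
    DividedPowers (RingHom.ker (Algebra.TensorProduct.productMap f g)) where
  dpow n z := if z ∈ RingHom.ker (Algebra.TensorProduct.productMap f g) then
    coeff n (tensorExp hI hJ z) else 0
  dpow_null hz := if_neg hz
  dpow_zero hz := by rw [if_pos hz, (isPreDividedPowers_tensorExp hI hJ).zero hz]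
  dpow_one hz := by rw [if_pos hz, coeff_one_tensorExp hI hJ hz]
  dpow_mem hn hz := by
    rw [if_pos hz]
    exact coeff_tensorExp_mem hI hJ hz _ hn
  dpow_add hz hw := by
    simp only [if_pos hz, if_pos hw, if_pos (add_mem hz hw)]
    exact (isPreDividedPowers_tensorExp hI hJ).add hz hw
  dpow_mul {n c z} hz := by
    rw [if_pos hz, if_pos (Ideal.mul_mem_left _ c hz),
      (isPreDividedPowers_tensorExp hI hJ).mul hz]
  mul_dpow hz := by
    simp only [if_pos hz]
    exact tensorExp_coeff_mul_coeff hI hJ hz _ _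
  dpow_comp {m n z} hn hz := by
    simp only [if_pos hz, if_pos (coeff_tensorExp_mem hI hJ hz _ hn)]
    exact tensorExp_comp hI hJ hz m n hn

theorem tensor_dpow_tmul_of_mem_left {s : S} (hs : s ∈ RingHom.ker f) (t : T) (n : ℕ) :
    (tensor hI hJ).dpow n (s ⊗ₜ t) = hI.dpow n s ⊗ₜ (t ^ n) := by
  simp only [tensor, if_pos (tmul_mem_of_left (g := g) hs t),
    tensorExp_tmul_of_mem_left hI hJ hs, coeff_mk]

theorem tensor_dpow_tmul_of_mem_right (s : S) {t : T} (ht : t ∈ RingHom.ker g) (n : ℕ) :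
    (tensor hI hJ).dpow n (s ⊗ₜ t) = (s ^ n) ⊗ₜ hJ.dpow n t := by
  simp only [tensor, if_pos (tmul_mem_of_right (f := f) s ht),
    tensorExp_tmul_of_mem_right hI hJ s ht, coeff_mk]

/-- A divided power structure on the kernel of the augmentation of `S ⊗ T` is determined by its
values on the augmentation ideals of `S` and `T`. -/
theorem ext_tensor {D D' : DividedPowers (RingHom.ker (Algebra.TensorProduct.productMap f g))}
    (left : ∀ s ∈ RingHom.ker f, ∀ n, 1 ≤ n →
      D.dpow n (s ⊗ₜ[R] (1 : T)) = D'.dpow n (s ⊗ₜ[R] (1 : T)))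
    (right : ∀ t ∈ RingHom.ker g, ∀ n, 1 ≤ n →
      D.dpow n ((1 : S) ⊗ₜ[R] t) = D'.dpow n ((1 : S) ⊗ₜ[R] t)) : D = D' := by
  refine DividedPowers.ext _ _ fun n z hz ↦ ?_
  rcases n.eq_zero_or_pos with rfl | hn
  · rw [D.dpow_zero hz, D'.dpow_zero hz]
  induction hz using ker_productMap_induction generalizing n with
  | zero => rw [D.dpow_eval_zero hn.ne', D'.dpow_eval_zero hn.ne']
  | left s hs t =>
    have : s ⊗ₜ[R] t = (1 ⊗ₜ t) * (s ⊗ₜ 1) := by simp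
    rw [this, D.dpow_mul (tmul_mem_of_left hs 1), D'.dpow_mul (tmul_mem_of_left hs 1),
      left s hs n hn]
  | right s t ht =>
    have : s ⊗ₜ[R] t = (s ⊗ₜ 1) * (1 ⊗ₜ t) := by simp
    rw [this, D.dpow_mul (tmul_mem_of_right 1 ht), D'.dpow_mul (tmul_mem_of_right 1 ht),
      right t ht n hn]
  | add u v hu hv hu' hv' =>
    rw [D.dpow_add hu hv, D'.dpow_add hu hv]
    refine sum_congr rfl fun k _ ↦ ?_
    congr 1
    · rcases k.1.eq_zero_or_pos with hk | hk
      · rw [hk, D.dpow_zero hu, D'.dpow_zero hu]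
      · exact hu' _ hk
    · rcases k.2.eq_zero_or_pos with hk | hk
      · rw [hk, D.dpow_zero hv, D'.dpow_zero hv]
      · exact hv' _ hk

end Augmented

end DividedPowers

/-- there is a unique divided power structure on the kernel of the augmentation
of `(Unitization R A) ⊗[R] (Unitization R B)` extending the given divided power structures on
the augmentation ideals of the two factors. -/
theorem existsUnique_dividedPowers_tensor (R : Type*) [CommRing R]
    (A : Type*) [NonUnitalCommRing A] [Module R A] [IsScalarTower R A A] [SMulCommClass R A A]
    (B : Type*) [NonUnitalCommRing B] [Module R B] [IsScalarTower R B B] [SMulCommClass R B B]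
    (hA : DividedPowers (RingHom.ker (Unitization.fstHom R A)))
    (hB : DividedPowers (RingHom.ker (Unitization.fstHom R B)))
    (K : Ideal (Unitization R A ⊗[R] Unitization R B))
    (hK : K = RingHom.ker
      (Algebra.TensorProduct.productMap (Unitization.fstHom R A) (Unitization.fstHom R B))) :
    ∃! D : DividedPowers K,
      (∀ a ∈ RingHom.ker (Unitization.fstHom R A), ∀ n : ℕ, 1 ≤ n →
        D.dpow n (a ⊗ₜ[R] (1 : Unitization R B)) = (hA.dpow n a) ⊗ₜ[R] (1 : Unitization R B)) ∧
      (∀ b ∈ RingHom.ker (Unitization.fstHom R B), ∀ n : ℕ, 1 ≤ n →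
        D.dpow n ((1 : Unitization R A) ⊗ₜ[R] b) = (1 : Unitization R A) ⊗ₜ[R] (hB.dpow n b)) := by
  subst hK
  refine ⟨hA.tensor hB, ⟨fun a ha n _ ↦ ?_, fun b hb n _ ↦ ?_⟩, fun D hD ↦ ?_⟩
  · rw [DividedPowers.tensor_dpow_tmul_of_mem_left hA hB ha, one_pow]
  · rw [DividedPowers.tensor_dpow_tmul_of_mem_right hA hB 1 hb, one_pow]
  · refine DividedPowers.ext_tensor (fun a ha n hn ↦ ?_) (fun b hb n hn ↦ ?_)
    · rw [hD.1 a ha n hn, DividedPowers.tensor_dpow_tmul_of_mem_left hA hB ha, one_pow]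
    · rw [hD.2 b hb n hn, DividedPowers.tensor_dpow_tmul_of_mem_right hA hB 1 hb, one_pow]
end

section
/- For every prime number p and every natural number k, the number Nat.uniformBell k p = (kp)! / (k! * (p!)^k) is congruent to 1 modulo p. -/
theorem Nat.choose_mul_add_sub_one_modEq_one {p : ℕ} (hp : p.Prime) (m : ℕ) :
    Nat.choose (m * p + p - 1) (p - 1) ≡ 1 [MOD p] := by
  have : Fact p.Prime := ⟨hp⟩
  have hlt : p - 1 < p := Nat.sub_lt hp.pos one_pos
  have hn : m * p + p - 1 = (p - 1) + p * m := by
    rw [Nat.add_sub_assoc hp.one_le, mul_comm, add_comm]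
  have h := Choose.choose_modEq_choose_mod_mul_choose_div_nat
    (n := m * p + p - 1) (k := p - 1) (p := p)
  simpa only [hn, Nat.add_mul_mod_self_left, Nat.mod_eq_of_lt hlt, Nat.div_eq_of_lt hlt,
    Nat.choose_self, Nat.choose_zero_right, mul_one] using h

/-- For a prime `p` and any `k`, `Nat.uniformBell k p ≡ 1 [MOD p]`. -/
theorem uniformBell_modEq_one (p k : ℕ) (hp : p.Prime) :
    Nat.uniformBell k p ≡ 1 [MOD p] := by
  induction k with
  | zero => rw [Nat.uniformBell_zero_left]
  | succ k ih =>
    rw [Nat.uniformBell_succ_left]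
    exact (Nat.choose_mul_add_sub_one_modEq_one hp k).mul ih
end

section
/- Let S be a commutative ring, I an ideal of S, hI : DividedPowers I a divided power structure, and a ∈ I. Then: (i) for all m, n ≥ 1, ((m+n).choose m) • hI.dpow (m+n) a ∈ I^2; (ii) if n ≥ 2 is not a prime power then hI.dpow n a ∈ I^2; and (iii) for every prime p and e ≥ 1, p • hI.dpow (p^e) a ∈ I^2. -/
theorem AddSubgroup.gcd_nsmul_mem {M : Type*} [AddCommGroup M] (N : AddSubgroup M) {x : M}
    {a b : ℕ} (ha : a • x ∈ N) (hb : b • x ∈ N) : Nat.gcd a b • x ∈ N := by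
  rw [← natCast_zsmul, Nat.gcd_eq_gcd_ab, add_zsmul, mul_comm (a : ℤ), mul_comm (b : ℤ),
    mul_zsmul, mul_zsmul, natCast_zsmul, natCast_zsmul]
  exact N.add_mem (N.zsmul_mem ha _) (N.zsmul_mem hb _)

theorem AddSubgroup.finset_gcd_nsmul_mem {M ι : Type*} [AddCommGroup M] (N : AddSubgroup M)
    {x : M} (s : Finset ι) (f : ι → ℕ) (h : ∀ i ∈ s, f i • x ∈ N) : s.gcd f • x ∈ N := by
  classical
  induction s using Finset.induction_on with
  | empty => simp
  | insert i s _ ih =>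
    rw [Finset.gcd_insert]
    exact N.gcd_nsmul_mem (h i (Finset.mem_insert_self i s))
      (ih fun j hj => h j (Finset.mem_insert_of_mem hj))

theorem DividedPowers.choose_nsmul_dpow_mem_sq {S : Type*} [CommRing S] {I : Ideal S}
    (hI : DividedPowers I) {a : S} (ha : a ∈ I) {m n : ℕ} (hm : m ≠ 0) (hn : n ≠ 0) :
    ((m + n).choose m) • hI.dpow (m + n) a ∈ I ^ 2 := by
  rw [nsmul_eq_mul, ← hI.mul_dpow ha, sq]
  exact Ideal.mul_mem_mul (hI.dpow_mem hm ha) (hI.dpow_mem hn ha)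

theorem DividedPowers.gcd_choose_nsmul_dpow_mem_sq {S : Type*} [CommRing S] {I : Ideal S}
    (hI : DividedPowers I) {a : S} (ha : a ∈ I) (n : ℕ) :
    (Finset.Icc 1 (n - 1)).gcd n.choose • hI.dpow n a ∈ I ^ 2 := by
  refine AddSubgroup.finset_gcd_nsmul_mem (I ^ 2).toAddSubgroup _ _ fun i hi => ?_
  rw [Finset.mem_Icc] at hi
  obtain ⟨k, rfl⟩ := Nat.exists_eq_add_of_le (show i ≤ n by lia)
  exact hI.choose_nsmul_dpow_mem_sq ha (by lia) (by lia)

/-- For a divided power structure on an ideal `I` and `a ∈ I`: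
(i) `((m+n).choose m) • dpow (m+n) a ∈ I ^ 2` for `m, n ≥ 1`;
(ii) `dpow n a ∈ I ^ 2` if `n ≥ 2` is not a prime power;
(iii) `p • dpow (p^e) a ∈ I ^ 2` for `p` prime and `e ≥ 1`. -/
theorem dpow_mem_sq {S : Type*} [CommRing S] {I : Ideal S}
    (hI : DividedPowers I) (a : S) (ha : a ∈ I) :
    (∀ m n : ℕ, 1 ≤ m → 1 ≤ n → ((m + n).choose m) • hI.dpow (m + n) a ∈ I ^ 2) ∧
    (∀ n : ℕ, 2 ≤ n → ¬ IsPrimePow n → hI.dpow n a ∈ I ^ 2) ∧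
    (∀ p e : ℕ, p.Prime → 1 ≤ e → p • hI.dpow (p ^ e) a ∈ I ^ 2) := by
  refine ⟨fun m n hm hn => hI.choose_nsmul_dpow_mem_sq ha (by lia) (by lia),
    fun n hn hpp => ?_, fun p e hp he => ?_⟩
  · simpa [Choose.gcd_choose_eq_one_of_not_isPrimePow hn hpp] using
      hI.gcd_choose_nsmul_dpow_mem_sq ha n
  · have h := hI.gcd_choose_nsmul_dpow_mem_sq ha (p ^ e)
    rwa [Choose.gcd_choose_eq_minFac_of_isPrimePow (hp.isPrimePow.pow (by lia)),
      hp.pow_minFac (by lia)] at h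
end

section
/- Let S be a commutative ring, J an ideal of S with divided power structure hJ : DividedPowers J, and let I ⊆ J be an ideal that is closed under the divided powers (i.e. hJ.dpow n x ∈ I for all n ≥ 1 and x ∈ I). Then for every prime p, every a ∈ J, and every ω ∈ I, one has hJ.dpow p (a * ω) ∈ I^2. -/
/-- If `I ⊆ J` is an ideal closed under the divided powers of a divided power
structure on `J`, then for `p` prime, `a ∈ J` and `ω ∈ I`, `dpow p (a * ω) ∈ I ^ 2`. -/
theorem dpow_mul_mem_sq {S : Type*} [CommRing S] {J : Ideal S} (hJ : DividedPowers J)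
    {I : Ideal S} (hIJ : I ≤ J)
    (hclosed : ∀ n : ℕ, 1 ≤ n → ∀ x ∈ I, hJ.dpow n x ∈ I) :
    ∀ p : ℕ, p.Prime → ∀ a ∈ J, ∀ ω ∈ I, hJ.dpow p (a * ω) ∈ I ^ 2 := by
  intro p hp a ha ω hω
  rw [hJ.dpow_mul_right ha]
  exact Ideal.mul_mem_left _ _ (Ideal.pow_le_pow_right hp.two_le (Ideal.pow_mem_pow hω p))
end

section
/- Let S be a commutative ring, I an ideal of S with divided power structure hI : DividedPowers I, M an S-module equipped with a DP-module family φ, and let d : S → M be an additive map satisfying the Leibniz rule d(ab) = a • d b + b • d a for all a, b ∈ S and the compatibility d (hI.dpow n a) = φ n (d a) + ∑_{i=1}^{n-1} (hI.dpow i a) • φ (n-i) (d a) for all a ∈ I, n ≥ 1. Then for all primes p and q and all a, b ∈ I: φ p (d (a * b)) = 0, and φ p (d (hI.dpow q a)) = φ p (φ p (d a)) if p = q, while φ p (d (hI.dpow q a)) = 0 if p ≠ q. -/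
namespace DPModuleFamily

variable {S : Type*} [CommRing S] {M : Type*} [AddCommGroup M] [Module S M]

/-- `φ n` is killed by `n` for `n ≥ 2`. -/
lemma nsmul_phi (φ : DPModuleFamily S M) {n : ℕ} (hn : 2 ≤ n) (x : M) :
    n • φ.phi n x = 0 := by
  have h := φ.choose_smul_phi 1 (n - 1) le_rfl (by omega) x
  rwa [show 1 + (n - 1) = n by omega, Nat.choose_one_right] at h

/-- `φ n` vanishes on `I • M` for `n ≥ 2` if `I` carries a divided power structure. -/
lemma phi_smul_eq_zero (φ : DPModuleFamily S M) {I : Ideal S} (hI : DividedPowers I)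
    {n : ℕ} (hn : 2 ≤ n) {a : S} (ha : a ∈ I) (x : M) : φ.phi n (a • x) = 0 := by
  rw [φ.phi_smul n (by omega), ← hI.factorial_mul_dpow_eq_pow ha, mul_comm, mul_smul,
    Nat.cast_smul_eq_nsmul]
  obtain ⟨k, hk⟩ := Nat.dvd_factorial (by omega : 0 < n) le_rfl
  rw [hk, mul_comm, mul_smul, φ.nsmul_phi hn, smul_zero, smul_zero]

/-- `φ m ∘ φ n = 0` for coprime `m, n ≥ 2`. -/
lemma phi_phi_eq_zero_of_coprime (φ : DPModuleFamily S M) {m n : ℕ} (hm : 2 ≤ m)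
    (hn : 2 ≤ n) (hmn : m.Coprime n) (x : M) : φ.phi m (φ.phi n x) = 0 := by
  have h₁ := φ.nsmul_phi hm (φ.phi n x)
  have h₂ : n • φ.phi m (φ.phi n x) = 0 := by
    rw [← map_nsmul, φ.nsmul_phi hn, map_zero]
  rw [← AddMonoid.addOrderOf_eq_one_iff, ← Nat.dvd_one, ← hmn.gcd_eq_one]
  exact Nat.dvd_gcd (addOrderOf_dvd_of_nsmul_eq_zero h₁) (addOrderOf_dvd_of_nsmul_eq_zero h₂)

end DPModuleFamily

/-- consequences of the Leibniz rule and the divided power compatibility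
for `φ p ∘ d` on products and on divided powers. -/
theorem phi_d_mul_and_dpow {S : Type*} [CommRing S] {I : Ideal S}
    (hI : DividedPowers I) {M : Type*} [AddCommGroup M] [Module S M]
    (φ : DPModuleFamily S M) (d : S →+ M)
    (hLeib : ∀ a b : S, d (a * b) = a • d b + b • d a)
    (hcompat : ∀ a ∈ I, ∀ n : ℕ, 1 ≤ n →
      d (hI.dpow n a) = φ.phi n (d a) +
        ∑ i ∈ Finset.Ico 1 n, hI.dpow i a • φ.phi (n - i) (d a)) :
    ∀ p q : ℕ, p.Prime → q.Prime → ∀ a ∈ I, ∀ b ∈ I,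
      (φ.phi p (d (a * b)) = 0) ∧
      (p = q → φ.phi p (d (hI.dpow q a)) = φ.phi p (φ.phi p (d a))) ∧
      (p ≠ q → φ.phi p (d (hI.dpow q a)) = 0) := by
  intro p q hp hq a ha b hb
  have key : φ.phi p (d (hI.dpow q a)) = φ.phi p (φ.phi q (d a)) := by
    rw [hcompat a ha q hq.one_le, map_add, map_sum, Finset.sum_eq_zero, add_zero]
    intro i hi
    have hi₀ : i ≠ 0 := by have := (Finset.mem_Ico.mp hi).1; omega
    exact φ.phi_smul_eq_zero hI hp.two_le (hI.dpow_mem hi₀ ha) _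
  refine ⟨?_, ?_, fun hpq => ?_⟩
  · rw [hLeib, map_add, φ.phi_smul_eq_zero hI hp.two_le ha,
      φ.phi_smul_eq_zero hI hp.two_le hb, add_zero]
  · rintro rfl
    exact key
  · rw [key]
    exact φ.phi_phi_eq_zero_of_coprime hp.two_le hq.two_le
      ((Nat.coprime_primes hp hq).mpr hpq) _
end

section
/- Let A be a commutative ring, M an A-module, γ : ℕ → A a function with γ 0 = 1 and γ i * γ j = ((i+j).choose i) • γ (i+j) for all i, j ≥ 0, and let φ : ℕ → M be any function. Define x : ℕ → M by x n = ∑_{j=1}^{n} γ (n-j) • φ j. Then for every n ≥ 1: ∑_{i=0}^{n-1} (-1)^i • (γ i • x (n-i)) = φ n (the sign (-1)^i acting as an integer scalar on M). -/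
/-- The alternating self-convolution of a divided-power-like family vanishes in positive degree. -/
theorem sum_range_neg_one_pow_zsmul_mul_eq_ite {A : Type*} [CommRing A]
    (γ : ℕ → A) (hγ0 : γ 0 = 1)
    (hγ : ∀ i j : ℕ, γ i * γ j = ((i + j).choose i) • γ (i + j)) (m : ℕ) :
    ∑ i ∈ Finset.range (m + 1), ((-1 : ℤ) ^ i) • (γ i * γ (m - i)) = if m = 0 then 1 else 0 := by
  have hterm : ∀ i ∈ Finset.range (m + 1),
      ((-1 : ℤ) ^ i) • (γ i * γ (m - i)) = ((-1 : ℤ) ^ i * (m.choose i : ℤ)) • γ m := by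
    intro i hi
    rw [hγ, Nat.add_sub_cancel' (Finset.mem_range_succ_iff.mp hi), mul_smul, natCast_zsmul]
  rw [Finset.sum_congr rfl hterm, ← Finset.sum_smul, Int.alternating_sum_range_choose]
  split_ifs with hm
  · rw [hm, hγ0, one_smul]
  · rw [zero_smul]

/-- inversion of a lower triangular system defined by a divided-power-like
family of scalars `γ`. -/
theorem inversion_formula {A : Type*} [CommRing A] {M : Type*} [AddCommGroup M] [Module A M]
    (γ : ℕ → A) (hγ0 : γ 0 = 1)
    (hγ : ∀ i j : ℕ, γ i * γ j = ((i + j).choose i) • γ (i + j))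
    (φ : ℕ → M) (x : ℕ → M)
    (hx : ∀ n, x n = ∑ j ∈ Finset.Icc 1 n, γ (n - j) • φ j) :
    ∀ n : ℕ, 1 ≤ n →
      ∑ i ∈ Finset.range n, ((-1 : ℤ) ^ i) • (γ i • x (n - i)) = φ n := by
  intro n hn
  calc
    ∑ i ∈ Finset.range n, ((-1 : ℤ) ^ i) • (γ i • x (n - i))
        = ∑ i ∈ Finset.range n, ∑ j ∈ Finset.Icc 1 (n - i),
            (((-1 : ℤ) ^ i) • (γ i * γ (n - j - i))) • φ j := by
      refine Finset.sum_congr rfl fun i _ => ?_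
      rw [hx, Finset.smul_sum, Finset.smul_sum]
      refine Finset.sum_congr rfl fun j _ => ?_
      rw [smul_assoc, mul_smul, Nat.sub_right_comm]
    _ = ∑ j ∈ Finset.Icc 1 n, ∑ i ∈ Finset.range (n - j + 1),
            (((-1 : ℤ) ^ i) • (γ i * γ (n - j - i))) • φ j := by
      refine Finset.sum_comm' fun i j => ?_
      simp only [Finset.mem_range, Finset.mem_Icc]
      omega
    _ = ∑ j ∈ Finset.Icc 1 n, if j = n then φ j else 0 := by
      refine Finset.sum_congr rfl fun j hj => ?_
      have hjn : n - j = 0 ↔ j = n := by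
        have := (Finset.mem_Icc.mp hj).2
        omega
      rw [← Finset.sum_smul, sum_range_neg_one_pow_zsmul_mul_eq_ite γ hγ0 hγ]
      simp only [hjn, ite_smul, one_smul, zero_smul]
    _ = φ n := by
      rw [Finset.sum_ite_eq_of_mem' _ _ _ (Finset.mem_Icc.mpr ⟨hn, le_rfl⟩)]
end

section
/- Let S be a commutative ring, I an ideal of S with divided power structure hI : DividedPowers I, M an S-module equipped with a DP-module family ψ, and let d : S → M be a function satisfying d (hI.dpow n a) = ψ n (d a) + ∑_{i=1}^{n-1} (hI.dpow i a) • ψ (n-i) (d a) for all a ∈ I and n ≥ 1. Then for every a ∈ I and every n ≥ 1: ψ n (d a) = ∑_{i=0}^{n-1} (-1)^i • ((hI.dpow i a) • d (hI.dpow (n-i) a)), where hI.dpow 0 a = 1 and the sign (-1)^i acts as an integer scalar. -/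
/-- The alternating convolution of the divided powers of `a` with themselves is trivial. -/
theorem DividedPowers.sum_range_neg_one_pow_mul_dpow_mul_dpow {S : Type*} [CommRing S]
    {I : Ideal S} (hI : DividedPowers I) {a : S} (ha : a ∈ I) (k : ℕ) :
    ∑ i ∈ Finset.range (k + 1), (-1 : S) ^ i * (hI.dpow i a * hI.dpow (k - i) a) =
      if k = 0 then 1 else 0 := by
  have h : ∀ i ∈ Finset.range (k + 1),
      (-1 : S) ^ i * (hI.dpow i a * hI.dpow (k - i) a) =
        (((-1 : ℤ) ^ i * (k.choose i : ℤ) : ℤ) : S) * hI.dpow k a := by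
    intro i hi
    have hik : i + (k - i) = k := by
      have := Finset.mem_range.mp hi
      omega
    rw [hI.mul_dpow ha, hik]
    push_cast
    ring
  rw [Finset.sum_congr rfl h, ← Finset.sum_mul, ← Int.cast_sum,
    Int.alternating_sum_range_choose]
  split_ifs with hk
  · simp [hk, hI.dpow_zero ha]
  · simp

/-- recovering `ψ n (d a)` from the values `d (dpow i a)`. -/
theorem psi_d_eq_alternating_sum {S : Type*} [CommRing S] {I : Ideal S}
    (hI : DividedPowers I) {M : Type*} [AddCommGroup M] [Module S M]
    (ψ : DPModuleFamily S M) (d : S → M)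
    (hd : ∀ a ∈ I, ∀ n : ℕ, 1 ≤ n →
      d (hI.dpow n a) = ψ.phi n (d a) +
        ∑ i ∈ Finset.Ico 1 n, hI.dpow i a • ψ.phi (n - i) (d a)) :
    ∀ a ∈ I, ∀ n : ℕ, 1 ≤ n →
      ψ.phi n (d a) =
        ∑ i ∈ Finset.range n, ((-1 : ℤ) ^ i) • (hI.dpow i a • d (hI.dpow (n - i) a)) := by
  intro a ha n hn
  have hd' : ∀ m, 1 ≤ m → d (hI.dpow m a) =
      ∑ j ∈ Finset.range m, hI.dpow j a • ψ.phi (m - j) (d a) := by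
    intro m hm
    rw [hd a ha m hm, Finset.range_eq_Ico, Finset.sum_eq_sum_Ico_succ_bot hm,
      hI.dpow_zero ha, one_smul, Nat.sub_zero]
  symm
  calc
    _ = ∑ i ∈ Finset.range n, ∑ j ∈ Finset.range (n - i),
          ((-1 : S) ^ i * (hI.dpow i a * hI.dpow j a)) • ψ.phi (n - (i + j)) (d a) := by
      refine Finset.sum_congr rfl fun i hi => ?_
      have hin := Finset.mem_range.mp hi
      rw [hd' _ (by omega), Finset.smul_sum, Finset.smul_sum]
      refine Finset.sum_congr rfl fun j _ => ?_
      rw [mul_smul, mul_smul, Nat.sub_sub, ← Int.cast_smul_eq_zsmul S]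
      push_cast
      rfl
    _ = ∑ k ∈ Finset.range n, ∑ i ∈ Finset.range (k + 1),
          ((-1 : S) ^ i * (hI.dpow i a * hI.dpow (k - i) a)) •
            ψ.phi (n - (i + (k - i))) (d a) :=
      (Finset.sum_range_diag_flip n fun i j =>
        ((-1 : S) ^ i * (hI.dpow i a * hI.dpow j a)) • ψ.phi (n - (i + j)) (d a)).symm
    _ = ∑ k ∈ Finset.range n, (if k = 0 then (1 : S) else 0) • ψ.phi (n - k) (d a) := by
      refine Finset.sum_congr rfl fun k _ => ?_
      rw [← hI.sum_range_neg_one_pow_mul_dpow_mul_dpow ha k, Finset.sum_smul]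
      refine Finset.sum_congr rfl fun i hi => ?_
      rw [Nat.add_sub_cancel' (Nat.lt_succ_iff.mp (Finset.mem_range.mp hi))]
    _ = ψ.phi n (d a) := by
      rw [Finset.sum_eq_single_of_mem 0 (Finset.mem_range.mpr hn)
        fun k _ hk => by rw [if_neg hk, zero_smul]]
      simp
end
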